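/- arXiv:2211.12189 — 4 statements merged into one kernel-verified Lean document; each statement's English description precedes it below -/
import Mathlib

section
/- Let d ≥ 1. There exists a constant C > 0, depending only on d, such that for all h₁, h₂ ∈ (0,1) and all x, z ∈ 𝕋^d one has ∫_{𝕋^d} κ_{h₁}(x−y) κ_{h₂}(y−z) dy ≤ C ( κ_{h₁}(x−z) + κ_{h₂}(x−z) ). -/
open MeasureTheory Real

noncomputable section

instance : Fact ((0:ℝ) < 2 * π) := ⟨by positivity⟩

/-- The flat torus `𝕋^d = [-π, π]^d`, realized as a product of circles of
circumference `2π`. -/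
abbrev Torus (d : ℕ) := Fin d → AddCircle (2 * π)

/-- The distance of a point of the torus to `0` (Euclidean combination of the
coordinatewise circle distances). -/
noncomputable def tnorm {d : ℕ} (z : Torus d) : ℝ :=
  Real.sqrt (∑ i, ‖z i‖ ^ 2)

/-- The kernel `K_h(z) = (|z|+h)^{-d}` for `|z| ≤ 1/2`, `(1/2+h)^{-d}` otherwise. -/
noncomputable def Kh (d : ℕ) (h : ℝ) (z : Torus d) : ℝ :=
  if tnorm z ≤ 1/2 then ((tnorm z + h) ^ d)⁻¹ else ((1/2 + h) ^ d)⁻¹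

/-- The normalized kernel `κ_h = K_h / ‖K_h‖_{L¹(𝕋^d)}`. -/
noncomputable def kappa (d : ℕ) (h : ℝ) (z : Torus d) : ℝ :=
  Kh d h z / ∫ y, Kh d h y

lemma tnorm_eq_norm_toLp {d : ℕ} (z : Torus d) : tnorm z = ‖WithLp.toLp 2 z‖ := by
  rw [PiLp.norm_eq_of_L2]
  rfl

lemma tnorm_nonneg {d : ℕ} (z : Torus d) : 0 ≤ tnorm z := Real.sqrt_nonneg _

lemma tnorm_add_le {d : ℕ} (z w : Torus d) : tnorm (z + w) ≤ tnorm z + tnorm w := by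
  simp only [tnorm_eq_norm_toLp, WithLp.toLp_add]
  exact norm_add_le _ _

lemma tnorm_neg {d : ℕ} (z : Torus d) : tnorm (-z) = tnorm z := by
  simp only [tnorm, Pi.neg_apply, norm_neg]

lemma continuous_tnorm {d : ℕ} : Continuous (tnorm : Torus d → ℝ) := by
  unfold tnorm
  fun_prop

lemma Kh_eq_min (d : ℕ) (h : ℝ) (z : Torus d) :
    Kh d h z = ((min (tnorm z) (1 / 2) + h) ^ d)⁻¹ := by
  unfold Kh
  split_ifs with hz
  · rw [min_eq_left hz]
  · rw [min_eq_right (le_of_not_ge hz)]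

lemma min_tnorm_add_pos {d : ℕ} {h : ℝ} (hh : 0 < h) (z : Torus d) :
    0 < min (tnorm z) (1 / 2) + h := by
  have : 0 ≤ min (tnorm z) (1 / 2) := le_min (tnorm_nonneg z) (by norm_num)
  linarith

lemma Kh_nonneg {d : ℕ} {h : ℝ} (hh : 0 < h) (z : Torus d) : 0 ≤ Kh d h z := by
  rw [Kh_eq_min]
  have := min_tnorm_add_pos hh z
  positivity

lemma kappa_nonneg {d : ℕ} {h : ℝ} (hh : 0 < h) (z : Torus d) : 0 ≤ kappa d h z :=
  div_nonneg (Kh_nonneg hh z) (integral_nonneg fun y => Kh_nonneg hh y)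

lemma continuous_kappa {d : ℕ} {h : ℝ} (hh : 0 < h) : Continuous (kappa d h) := by
  have hK : Continuous (Kh d h) := by
    rw [funext (Kh_eq_min d h)]
    exact (((continuous_tnorm.min continuous_const).add continuous_const).pow d).inv₀
      fun z => (pow_pos (min_tnorm_add_pos hh z) d).ne'
  exact hK.div_const _

lemma Continuous.integrable_torus {d : ℕ} {f : Torus d → ℝ} (hf : Continuous f) :
    Integrable f :=
  hf.integrable_of_hasCompactSupport (HasCompactSupport.of_compactSpace f)

lemma kappa_neg (d : ℕ) (h : ℝ) (z : Torus d) : kappa d h (-z) = kappa d h z := by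
  simp only [kappa, Kh, tnorm_neg]

lemma integral_kappa_le_one (d : ℕ) (h : ℝ) : ∫ y, kappa d h y ≤ 1 := by
  simp only [kappa, integral_div]
  exact div_self_le_one _

/-- If `w` is at least half as far from the origin as `z`, up to the cut-off, then
`κ_h(w) ≤ 2^d κ_h(z)`. -/
lemma kappa_le_two_pow_mul {d : ℕ} {h : ℝ} (hh : 0 < h) {z w : Torus d}
    (hzw : min (tnorm z) (1 / 2) ≤ 2 * min (tnorm w) (1 / 2)) :
    kappa d h w ≤ 2 ^ d * kappa d h z := by
  have hw := min_tnorm_add_pos hh w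
  have hz := min_tnorm_add_pos hh z
  unfold kappa
  rw [← mul_div_assoc]
  refine div_le_div_of_nonneg_right ?_ (integral_nonneg fun y => Kh_nonneg hh y)
  rw [Kh_eq_min, Kh_eq_min, ← div_eq_mul_inv, ← div_pow, ← inv_pow]
  refine pow_le_pow_left₀ (by positivity) ?_ d
  rw [inv_eq_one_div, div_le_div_iff₀ hw hz]
  linarith

lemma min_half_tnorm_add_le {d : ℕ} (u v : Torus d) :
    min (tnorm (u + v)) (1 / 2) ≤ min (tnorm u) (1 / 2) + min (tnorm v) (1 / 2) := by
  have := tnorm_add_le u v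
  have := tnorm_nonneg u
  have := tnorm_nonneg v
  rcases le_total (tnorm u) (1 / 2) with hu | hu <;> rcases le_total (tnorm v) (1 / 2) with hv | hv <;>
    simp only [min_eq_left, min_eq_right, hu, hv] <;>
    first
    | exact (min_le_left _ _).trans (by linarith)
    | exact (min_le_right _ _).trans (by linarith)

/-- Pointwise bound on the product of two kernels: one of `u`, `v` is at least half as far from
the origin as `u + v`. -/
lemma kappa_mul_kappa_le {d : ℕ} {h₁ h₂ : ℝ} (hh₁ : 0 < h₁) (hh₂ : 0 < h₂) (u v : Torus d) :
    kappa d h₁ u * kappa d h₂ v ≤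
      2 ^ d * kappa d h₁ (u + v) * kappa d h₂ v + 2 ^ d * kappa d h₂ (u + v) * kappa d h₁ u := by
  have h1 := kappa_nonneg hh₁ u
  have h2 := kappa_nonneg hh₂ v
  have h3 := kappa_nonneg hh₁ (u + v)
  have h4 := kappa_nonneg hh₂ (u + v)
  have htri := min_half_tnorm_add_le u v
  rcases le_total (min (tnorm u) (1 / 2)) (min (tnorm v) (1 / 2)) with huv | huv
  · have hv := kappa_le_two_pow_mul hh₂ (z := u + v) (w := v) (by linarith)
    have hmul := mul_le_mul_of_nonneg_left hv h1
    have : 0 ≤ 2 ^ d * kappa d h₁ (u + v) * kappa d h₂ v := by positivity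
    linarith
  · have hu := kappa_le_two_pow_mul hh₁ (z := u + v) (w := u) (by linarith)
    have hmul := mul_le_mul_of_nonneg_right hu h2
    have : 0 ≤ 2 ^ d * kappa d h₂ (u + v) * kappa d h₁ u := by positivity
    linarith

/-- For `d ≥ 1` there is a constant `C > 0`, depending only on `d`,
such that for all `h₁, h₂ ∈ (0,1)` and all `x, z ∈ 𝕋^d`,
`∫_{𝕋^d} κ_{h₁}(x−y) κ_{h₂}(y−z) dy ≤ C (κ_{h₁}(x−z) + κ_{h₂}(x−z))`. -/
theorem convolution_of_normalized_kernels (d : ℕ) (hd : 1 ≤ d) :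
    ∃ C : ℝ, 0 < C ∧ ∀ h₁ h₂ : ℝ, h₁ ∈ Set.Ioo (0:ℝ) 1 → h₂ ∈ Set.Ioo (0:ℝ) 1 →
      ∀ x z : Torus d,
        (∫ y, kappa d h₁ (x - y) * kappa d h₂ (y - z)) ≤
          C * (kappa d h₁ (x - z) + kappa d h₂ (x - z)) := by
  refine ⟨2 ^ d, by positivity, fun h₁ h₂ hh₁ hh₂ x z => ?_⟩
  have hc₁ : Continuous fun y => kappa d h₁ (x - y) :=
    (continuous_kappa hh₁.1).comp (continuous_const.sub continuous_id)
  have hc₂ : Continuous fun y => kappa d h₂ (y - z) :=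
    (continuous_kappa hh₂.1).comp (continuous_id.sub continuous_const)
  have hI₁ : ∫ y, kappa d h₁ (x - y) ≤ 1 := by
    simp only [← neg_sub _ x, kappa_neg]
    rw [integral_sub_right_eq_self (kappa d h₁) x]
    exact integral_kappa_le_one d h₁
  have hI₂ : ∫ y, kappa d h₂ (y - z) ≤ 1 := by
    rw [integral_sub_right_eq_self (kappa d h₂) z]
    exact integral_kappa_le_one d h₂
  have hk₁ : 0 ≤ 2 ^ d * kappa d h₁ (x - z) := mul_nonneg (by positivity) (kappa_nonneg hh₁.1 _)
  have hk₂ : 0 ≤ 2 ^ d * kappa d h₂ (x - z) := mul_nonneg (by positivity) (kappa_nonneg hh₂.1 _)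
  have hi₁ := hc₁.integrable_torus.const_mul (2 ^ d * kappa d h₂ (x - z))
  have hi₂ := hc₂.integrable_torus.const_mul (2 ^ d * kappa d h₁ (x - z))
  calc ∫ y, kappa d h₁ (x - y) * kappa d h₂ (y - z)
      ≤ ∫ y, (2 ^ d * kappa d h₁ (x - z) * kappa d h₂ (y - z) +
          2 ^ d * kappa d h₂ (x - z) * kappa d h₁ (x - y)) := by
        refine integral_mono (hc₁.mul hc₂).integrable_torus (hi₂.add hi₁) fun y => ?_
        simpa only [sub_add_sub_cancel] using
          kappa_mul_kappa_le hh₁.1 hh₂.1 (x - y) (y - z)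
    _ = 2 ^ d * kappa d h₁ (x - z) * (∫ y, kappa d h₂ (y - z)) +
          2 ^ d * kappa d h₂ (x - z) * ∫ y, kappa d h₁ (x - y) := by
        rw [integral_add hi₂ hi₁, integral_const_mul, integral_const_mul]
    _ ≤ 2 ^ d * kappa d h₁ (x - z) * 1 + 2 ^ d * kappa d h₂ (x - z) * 1 := by gcongr
    _ = 2 ^ d * (kappa d h₁ (x - z) + kappa d h₂ (x - z)) := by ring

end
end

section
/- Let d ≥ 1. There exists a constant C > 0 depending only on d such that sup_{h ∈ (0,1)} ∫_{𝕋^d} K_h(z) |z| dz ≤ C; consequently there exist C' > 0 and h₀ ∈ (0,1) such that for every h ∈ (0, h₀) one has ∫_{𝕋^d} κ_h(z) |z| dz ≤ C' |ln h|^{−1}. -/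
open MeasureTheory Real

noncomputable section

lemma measurable_tnorm {d : ℕ} : Measurable (tnorm (d := d)) := by
  unfold tnorm
  exact Continuous.measurable (by fun_prop)

lemma integrable_circle_norm_rpow {s : ℝ} (hs : -1 < s) :
    Integrable fun x : AddCircle (2 * π) => ‖x‖ ^ s := by
  have hpos : IntervalIntegrable (fun x : ℝ => |x| ^ s) volume 0 π := by
    refine (intervalIntegral.intervalIntegrable_rpow' hs).congr fun x hx => ?_
    rw [Set.uIoc_of_le pi_pos.le] at hx
    simp only [abs_of_pos hx.1]
  have hneg : IntervalIntegrable (fun x : ℝ => |x| ^ s) volume (-π) 0 := by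
    have := (IntervalIntegrable.iff_comp_neg (by simp)).1 hpos
    simp only [abs_neg, neg_zero] at this
    exact this.symm
  have hmp := AddCircle.measurePreserving_mk (2 * π) (-π)
  have hmeas : Measurable fun x : AddCircle (2 * π) => ‖x‖ ^ s := by fun_prop
  rw [← hmp.integrable_comp hmeas.aestronglyMeasurable,
    show -π + 2 * π = π by ring]
  have h := (intervalIntegrable_iff_integrableOn_Ioc_of_le (by linarith [pi_pos])).1
    (hneg.trans hpos)
  refine h.congr ((ae_restrict_iff' measurableSet_Ioc).2 (.of_forall fun x hx => ?_))
  have hx' : ‖(x : AddCircle (2 * π))‖ = |x| := by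
    rw [AddCircle.norm_coe_eq_abs_iff _ (by positivity), abs_of_pos (by positivity : 0 < 2 * π)]
    rw [abs_le]; constructor <;> linarith [hx.1, hx.2]
  simp [hx']

lemma norm_apply_le_tnorm {d : ℕ} (z : Torus d) (i : Fin d) : ‖z i‖ ≤ tnorm z :=
  Real.le_sqrt_of_sq_le <|
    Finset.single_le_sum (f := fun i => ‖z i‖ ^ 2) (fun _ _ => by positivity) (Finset.mem_univ i)

lemma tnorm_le_of_forall_norm_le {d : ℕ} {z : Torus d} {r : ℝ} (hr : 0 ≤ r)
    (h : ∀ i, ‖z i‖ ≤ r) : tnorm z ≤ d * r := by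
  refine Real.sqrt_le_iff.2 ⟨by positivity, ?_⟩
  calc ∑ i, ‖z i‖ ^ 2 ≤ ∑ _i : Fin d, r ^ 2 :=
        Finset.sum_le_sum fun i _ => pow_le_pow_left₀ (norm_nonneg _) (h i) 2
    _ = d * r ^ 2 := by simp
    _ ≤ (d * r) ^ 2 := by
        rw [mul_pow]
        gcongr
        exact_mod_cast Nat.le_self_pow two_ne_zero d

lemma tnorm_le {d : ℕ} (z : Torus d) : tnorm z ≤ d * π :=
  tnorm_le_of_forall_norm_le pi_pos.le fun i => by
    have := AddCircle.norm_le_half_period (2 * π) (x := z i) (by positivity)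
    rwa [abs_of_pos (by positivity), mul_div_cancel_left₀ _ two_ne_zero] at this

lemma inv_le_Kh {d : ℕ} {h : ℝ} (hh : 0 < h) (z : Torus d) :
    ((tnorm z + h) ^ d)⁻¹ ≤ Kh d h z := by
  unfold Kh
  split_ifs with hz
  · rfl
  · gcongr
    exact (not_le.1 hz).le

lemma integrable_Kh {d : ℕ} {h : ℝ} (hh : 0 < h) : Integrable (Kh d h) := by
  have hmeas : Measurable (Kh d h) :=
    Measurable.ite (measurable_tnorm measurableSet_Iic)
      ((measurable_tnorm.add_const h).pow_const d).inv measurable_const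
  refine .of_bound hmeas.aestronglyMeasurable (h ^ d)⁻¹ (.of_forall fun z => ?_)
  rw [Real.norm_of_nonneg (Kh_nonneg hh z)]
  have := tnorm_nonneg z
  unfold Kh
  split_ifs <;> gcongr <;> linarith

lemma prod_rpow_le_tnorm_pow {d : ℕ} (hd : 1 ≤ d) (z : Torus d) :
    ∏ i, ‖z i‖ ^ ((d - 1 : ℝ) / d) ≤ tnorm z ^ (d - 1) := by
  have hd' : (1 : ℝ) ≤ d := by exact_mod_cast hd
  calc ∏ i, ‖z i‖ ^ ((d - 1 : ℝ) / d)
      ≤ ∏ _i : Fin d, tnorm z ^ ((d - 1 : ℝ) / d) := by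
        refine Finset.prod_le_prod (fun i _ => by positivity) fun i _ => ?_
        exact Real.rpow_le_rpow (norm_nonneg _) (norm_apply_le_tnorm z i)
          (div_nonneg (by linarith) (by linarith))
    _ = tnorm z ^ (d - 1) := by
        rw [Finset.prod_const, Finset.card_univ, Fintype.card_fin, ← Real.rpow_natCast,
          ← Real.rpow_mul (tnorm_nonneg z), div_mul_cancel₀ _ (by positivity),
          ← Nat.cast_pred hd, Real.rpow_natCast]

lemma Kh_mul_tnorm_le {d : ℕ} (hd : 1 ≤ d) {h : ℝ} (hh : 0 < h) {z : Torus d}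
    (hz : ∀ i, z i ≠ 0) :
    Kh d h z * tnorm z ≤ ∏ i, ‖z i‖ ^ (-((d - 1 : ℝ) / d)) + 2 ^ d * (d * π) := by
  have hprod : ∏ i, ‖z i‖ ^ (-((d - 1 : ℝ) / d)) = (∏ i, ‖z i‖ ^ ((d - 1 : ℝ) / d))⁻¹ := by
    rw [← Finset.prod_inv_distrib]
    exact Finset.prod_congr rfl fun i _ => Real.rpow_neg (norm_nonneg _) _
  have hpos : 0 < ∏ i, ‖z i‖ ^ ((d - 1 : ℝ) / d) :=
    Finset.prod_pos fun i _ => Real.rpow_pos_of_pos (norm_pos_iff.2 (hz i)) _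
  have ht : 0 < tnorm z := (norm_pos_iff.2 (hz ⟨0, hd⟩)).trans_le (norm_apply_le_tnorm z _)
  rw [hprod]
  unfold Kh
  split_ifs
  · calc ((tnorm z + h) ^ d)⁻¹ * tnorm z ≤ (tnorm z ^ d)⁻¹ * tnorm z := by
          gcongr; linarith
      _ = (tnorm z ^ (d - 1))⁻¹ := by
          obtain ⟨n, rfl⟩ := Nat.exists_eq_add_of_le' hd
          rw [Nat.add_sub_cancel, pow_succ]
          field_simp
      _ ≤ (∏ i, ‖z i‖ ^ ((d - 1 : ℝ) / d))⁻¹ := inv_anti₀ hpos (prod_rpow_le_tnorm_pow hd z)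
      _ ≤ _ := le_add_of_nonneg_right (by positivity)
  · calc ((1 / 2 + h) ^ d)⁻¹ * tnorm z ≤ ((1 / 2) ^ d)⁻¹ * (d * π) := by
          gcongr
          · linarith
          · exact tnorm_le z
      _ = 2 ^ d * (d * π) := by simp
      _ ≤ _ := le_add_of_nonneg_left (by positivity)

lemma exists_integral_Kh_mul_tnorm_le {d : ℕ} (hd : 1 ≤ d) :
    ∃ C : ℝ, 0 < C ∧ ∀ h : ℝ, 0 < h → ∫ z, Kh d h z * tnorm z ≤ C := by
  have hd' : (1 : ℝ) ≤ d := by exact_mod_cast hd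
  have hs : -1 < -((d - 1 : ℝ) / d) := by
    rw [neg_lt_neg_iff, div_lt_one (by linarith)]
    linarith
  let g : Torus d → ℝ := fun z => ∏ i, ‖z i‖ ^ (-((d - 1 : ℝ) / d)) + 2 ^ d * (d * π)
  have hg : Integrable g :=
    (Integrable.fintype_prod fun _ => integrable_circle_norm_rpow hs).add (integrable_const _)
  have hg0 : 0 ≤ ∫ z, g z := integral_nonneg fun z => by positivity
  refine ⟨(∫ z, g z) + 1, by linarith, fun h hh => ?_⟩
  have : NullSingletonClass (volume : Measure (AddCircle (2 * π))) := ⟨fun x => by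
    rw [← Metric.closedBall_zero, AddCircle.volume_closedBall]
    simp [pi_pos.le]⟩
  have hne : ∀ᵐ z : Torus d, ∀ i, z i ≠ 0 := ae_all_iff.2 fun i => Measure.ae_eval_ne _ i 0
  refine (integral_mono_of_nonneg
    (.of_forall fun z => mul_nonneg (Kh_nonneg hh z) (tnorm_nonneg z)) hg ?_).trans
    (le_add_of_nonneg_right one_pos.le)
  filter_upwards [hne] with z hz using Kh_mul_tnorm_le hd hh hz

lemma volume_torus_closedBall {d : ℕ} {r : ℝ} (hr : 0 ≤ r) (hr' : r ≤ π) :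
    volume (Metric.closedBall (0 : Torus d) r) = ENNReal.ofReal ((2 * r) ^ d) := by
  rw [MeasureTheory.volume_pi_closedBall _ hr]
  simp only [AddCircle.volume_closedBall, min_eq_right (by linarith : 2 * r ≤ 2 * π)]
  rw [Finset.prod_const, Finset.card_univ, Fintype.card_fin, ENNReal.ofReal_pow (by positivity)]

lemma ofReal_le_volume_le_Kh {d : ℕ} (hd : 1 ≤ d) {h u : ℝ} (hh : 0 < h) (hu : 1 ≤ u)
    (huh : u ≤ ((2 * h) ^ d)⁻¹) :
    ENNReal.ofReal (((d : ℝ) ^ d)⁻¹ * u⁻¹) ≤ volume {z : Torus d | u ≤ Kh d h z} := by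
  have hd' : (1 : ℝ) ≤ d := by exact_mod_cast hd
  have hu0 : 0 < u := by linarith
  have hd0 : d ≠ 0 := by lia
  obtain ⟨r, hr0, hr⟩ : ∃ r : ℝ, 0 < r ∧ r ^ d = u⁻¹ :=
    ⟨u⁻¹ ^ (d : ℝ)⁻¹, by positivity, Real.rpow_inv_natCast_pow (by positivity) hd0⟩
  have hr1 : r ≤ 1 := by
    rw [← pow_le_one_iff_of_nonneg hr0.le hd0, hr]
    exact inv_le_one_of_one_le₀ hu
  have hhr : 2 * h ≤ r := by
    rw [← pow_le_pow_iff_left₀ (by positivity) hr0.le hd0, hr]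
    exact (le_inv_comm₀ hu0 (by positivity)).1 huh
  have hball : ENNReal.ofReal (((d : ℝ) ^ d)⁻¹ * u⁻¹) =
      volume (Metric.closedBall (0 : Torus d) (r / (2 * d))) := by
    rw [volume_torus_closedBall (by positivity), ← hr]
    · congr 1
      rw [← inv_pow, ← mul_pow]
      congr 1
      field_simp
    · calc r / (2 * d) ≤ r := div_le_self hr0.le (by linarith)
        _ ≤ π := by linarith [pi_gt_three]
  rw [hball]
  refine measure_mono fun z hz => ?_
  rw [mem_closedBall_zero_iff, pi_norm_le_iff_of_nonneg (by positivity)] at hz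
  have ht : tnorm z + h ≤ r := by
    have := tnorm_le_of_forall_norm_le (by positivity) hz
    rw [show (d : ℝ) * (r / (2 * d)) = r / 2 by field_simp] at this
    linarith
  have ht0 := tnorm_nonneg z
  calc u = (r ^ d)⁻¹ := by rw [hr, inv_inv]
    _ ≤ ((tnorm z + h) ^ d)⁻¹ := by gcongr
    _ ≤ Kh d h z := inv_le_Kh hh z

lemma log_le_integral_Kh {d : ℕ} (hd : 1 ≤ d) {h : ℝ} (hh : 0 < h) (hh' : 2 * h ≤ 1) :
    ((d : ℝ) ^ d)⁻¹ * Real.log ((2 * h) ^ d)⁻¹ ≤ ∫ z, Kh d h z := by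
  set T : ℝ := ((2 * h) ^ d)⁻¹
  have hT : 1 ≤ T := (one_le_inv₀ (by positivity)).2 (pow_le_one₀ (by positivity) hh')
  have hint : IntegrableOn (fun u : ℝ => ((d : ℝ) ^ d)⁻¹ * u⁻¹) (Set.Ioc 1 T) := by
    rw [← intervalIntegrable_iff_integrableOn_Ioc_of_le hT]
    refine (intervalIntegral.intervalIntegrable_inv (fun u hu => ?_) continuousOn_id).const_mul _
    rw [Set.uIcc_of_le hT] at hu
    exact (one_pos.trans_le hu.1).ne'
  have hval : ∫ u in Set.Ioc 1 T, ((d : ℝ) ^ d)⁻¹ * u⁻¹ = ((d : ℝ) ^ d)⁻¹ * Real.log T := by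
    rw [← intervalIntegral.integral_of_le hT, intervalIntegral.integral_const_mul,
      integral_inv_of_pos one_pos (by linarith), div_one]
  rw [← hval]
  have hK : 0 ≤ᵐ[volume] Kh d h := .of_forall (Kh_nonneg hh)
  refine (ENNReal.ofReal_le_ofReal_iff (integral_nonneg (Kh_nonneg hh))).1 ?_
  rw [ofReal_integral_eq_lintegral_ofReal (integrable_Kh hh) hK,
    lintegral_eq_lintegral_meas_le _ hK (integrable_Kh hh).aemeasurable,
    ofReal_integral_eq_lintegral_ofReal hint ((ae_restrict_iff' measurableSet_Ioc).2
      (.of_forall fun u hu => by have : 0 < u := one_pos.trans hu.1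
                                 simp only [Pi.zero_apply]; positivity))]
  calc _ ≤ ∫⁻ u in Set.Ioc 1 T, volume {z : Torus d | u ≤ Kh d h z} :=
        setLIntegral_mono' measurableSet_Ioc fun u hu => ofReal_le_volume_le_Kh hd hh hu.1.le hu.2
    _ ≤ _ := lintegral_mono_set fun u hu => one_pos.trans hu.1

lemma abs_log_le_integral_Kh {d : ℕ} (hd : 1 ≤ d) {h : ℝ} (hh : 0 < h) (hh' : h ≤ 1 / 4) :
    ((d : ℝ) ^ d)⁻¹ * (d / 2) * |Real.log h| ≤ ∫ z, Kh d h z := by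
  refine le_trans ?_ (log_le_integral_Kh hd hh (by linarith))
  rw [mul_assoc]
  gcongr
  have hlog : 2 * Real.log (2 * h) ≤ Real.log h := by
    rw [← Nat.cast_ofNat, ← Real.log_pow]
    exact Real.log_le_log (by positivity) (by push_cast; nlinarith)
  rw [abs_of_neg (Real.log_neg hh (by linarith)), Real.log_inv, Real.log_pow]
  nlinarith [(Nat.cast_nonneg d : (0 : ℝ) ≤ d)]

/-- For `d ≥ 1` there is a constant `C > 0` depending only on `d`
with `sup_{h ∈ (0,1)} ∫_{𝕋^d} K_h(z) |z| dz ≤ C`; consequently there are `C' > 0`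
and `h₀ ∈ (0,1)` such that for every `h ∈ (0, h₀)`,
`∫_{𝕋^d} κ_h(z) |z| dz ≤ C' |ln h|⁻¹`. -/
theorem K_times_dist_integral_bounds (d : ℕ) (hd : 1 ≤ d) :
    (∃ C : ℝ, 0 < C ∧ ∀ h ∈ Set.Ioo (0:ℝ) 1, (∫ z, Kh d h z * tnorm z) ≤ C) ∧
    (∃ C' h₀ : ℝ, 0 < C' ∧ h₀ ∈ Set.Ioo (0:ℝ) 1 ∧
      ∀ h ∈ Set.Ioo (0:ℝ) h₀, (∫ z, kappa d h z * tnorm z) ≤ C' * |Real.log h|⁻¹) := by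
  obtain ⟨C, hC, hCle⟩ := exists_integral_Kh_mul_tnorm_le hd
  refine ⟨⟨C, hC, fun h hh => hCle h hh.1⟩, ?_⟩
  have hd0 : (0 : ℝ) < d := by exact_mod_cast hd
  have hc : 0 < ((d : ℝ) ^ d)⁻¹ * (d / 2) := by positivity
  refine ⟨C / (((d : ℝ) ^ d)⁻¹ * (d / 2)), 1 / 4, by positivity, by norm_num, fun h hh => ?_⟩
  have hlog : 0 < |Real.log h| :=
    abs_pos.2 (Real.log_neg hh.1 (hh.2.trans (by norm_num))).ne
  calc ∫ z, kappa d h z * tnorm z = (∫ z, Kh d h z * tnorm z) / ∫ z, Kh d h z := by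
        rw [← integral_div]
        exact integral_congr_ae (.of_forall fun z => div_mul_eq_mul_div _ _ _)
    _ ≤ C / (((d : ℝ) ^ d)⁻¹ * (d / 2) * |Real.log h|) :=
        div_le_div₀ hC.le (hCle h hh.1) (by positivity) (abs_log_le_integral_Kh hd hh.1 hh.2.le)
    _ = C / (((d : ℝ) ^ d)⁻¹ * (d / 2)) * |Real.log h|⁻¹ := by
        rw [← div_div, div_eq_mul_inv _ |Real.log h|]

end
end

section
/- Let d ≥ 1. There exists a constant C > 0, depending only on d, such that for every continuously differentiable function u : ℝ^d → ℝ and all x, y ∈ ℝ^d with x ≠ y one has |u(x) − u(y)| ≤ C |x−y| ( D_{|x−y|} u(x) + D_{|x−y|} u(y) ), where for r > 0 the averaged gradient functional is D_r u(x) = (1/r) ∫_{B(0,r)} |∇u(x+z)| |z|^{−(d−1)} dz. -/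
open MeasureTheory Real

noncomputable section

/-- The averaged gradient functional
`D_r u(x) = (1/r) ∫_{B(0,r)} |∇u(x+z)| / |z|^{d−1} dz`. -/
noncomputable def Davg (d : ℕ) (u : EuclideanSpace ℝ (Fin d) → ℝ) (r : ℝ)
    (x : EuclideanSpace ℝ (Fin d)) : ℝ :=
  (1 / r) * ∫ z in Metric.ball (0 : EuclideanSpace ℝ (Fin d)) r,
    ‖fderiv ℝ u (x + z)‖ / ‖z‖ ^ (d - 1)

section RadialAverage

open Set Metric Module

variable {E : Type*} [NormedAddCommGroup E] [NormedSpace ℝ E]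

lemma enorm_sub_le_lintegral_fderiv {u : E → ℝ} (hu : ContDiff ℝ 1 u) (x z : E) :
    ‖u (x + z) - u x‖ₑ ≤ ∫⁻ t in Ioo (0 : ℝ) 1, ‖fderiv ℝ u (x + t • z)‖ₑ * ‖z‖ₑ := by
  have hγ : ContDiff ℝ 1 fun t : ℝ ↦ u (x + t • z) := by fun_prop
  have key := enorm_sub_le_lintegral_deriv_of_contDiffOn_Icc hγ.contDiffOn
    (zero_le_one : (0 : ℝ) ≤ 1)
  simp only [one_smul, zero_smul, add_zero] at key
  rw [restrict_Ioo_eq_restrict_Icc]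
  refine key.trans (lintegral_mono fun t ↦ ?_)
  have hd : HasDerivAt (fun t : ℝ ↦ u (x + t • z)) (fderiv ℝ u (x + t • z) z) t := by
    have h1 : HasDerivAt (fun t : ℝ ↦ x + t • z) z t := by
      simpa using ((hasDerivAt_id t).smul_const z).const_add x
    exact ((hu.differentiable one_ne_zero _).hasFDerivAt).comp_hasDerivAt t h1
  rw [hd.deriv]
  exact ContinuousLinearMap.le_opENorm _ _

lemma setLIntegral_Ioi_rpow_neg {n : ℕ} (hn : n ≠ 0) {a : ℝ} (ha : 0 < a) :
    ∫⁻ t in Ioi a, ENNReal.ofReal (t ^ (-(n + 1 : ℝ))) = ENNReal.ofReal ((a ^ n)⁻¹ / n) := by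
  have hn' : (0 : ℝ) < n := by positivity
  rw [← ofReal_integral_eq_lintegral_ofReal
    (integrableOn_Ioi_rpow_of_lt (by linarith) ha)
    ((ae_restrict_mem measurableSet_Ioi).mono fun t ht ↦ rpow_nonneg (ha.trans ht).le _),
    integral_Ioi_rpow_of_lt (by linarith) ha]
  congr 1
  rw [show -(n + 1 : ℝ) + 1 = -n by ring, neg_div_neg_eq, rpow_neg ha.le, rpow_natCast]

variable [FiniteDimensional ℝ E] [MeasurableSpace E] [BorelSpace E]
  (μ : Measure E) [μ.IsAddHaarMeasure]

lemma lintegral_comp_smul_of_pos {f : E → ENNReal} (hf : Measurable f) {t : ℝ} (ht : 0 < t) :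
    ∫⁻ z, f (t • z) ∂μ = ENNReal.ofReal (t ^ finrank ℝ E)⁻¹ * ∫⁻ z, f z ∂μ := by
  rw [← lintegral_map hf (measurable_const_smul t), Measure.map_addHaar_smul μ ht.ne',
    lintegral_smul_measure, abs_of_pos (by positivity), smul_eq_mul]

lemma setLIntegral_ball_comp_smul_mul_enorm {g : E → ENNReal} (hg : Measurable g) {r t : ℝ}
    (hr : 0 < r) (ht : t ∈ Ioo (0 : ℝ) 1) :
    ∫⁻ z in ball (0 : E) r, g (t • z) * ‖z‖ₑ ∂μ =
      ∫⁻ w in ball (0 : E) r, g w * ‖w‖ₑ * (Ioi (‖w‖ / r)).indicator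
        (fun s ↦ ENNReal.ofReal (s ^ (-(finrank ℝ E + 1 : ℝ)))) t ∂μ := by
  obtain ⟨ht0, ht1⟩ := ht
  have htr : t * r ≤ r := by nlinarith
  set F : E → ENNReal := (ball (0 : E) (t * r)).indicator fun w ↦ g w * ‖w‖ₑ with hF
  have hFm : Measurable F := (by fun_prop : Measurable fun w ↦ g w * ‖w‖ₑ).indicator
    measurableSet_ball
  have hl : ∀ z : E, (ball (0 : E) r).indicator (fun z ↦ g (t • z) * ‖z‖ₑ) z =
      ENNReal.ofReal t⁻¹ * F (t • z) := by
    intro z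
    have hmem : t • z ∈ ball (0 : E) (t * r) ↔ z ∈ ball (0 : E) r := by
      simp [norm_smul, abs_of_pos ht0, ht0]
    by_cases hz : z ∈ ball (0 : E) r
    · rw [hF, indicator_of_mem hz, indicator_of_mem (hmem.2 hz), enorm_smul,
        Real.enorm_of_nonneg ht0.le, mul_left_comm, ← mul_assoc (ENNReal.ofReal t⁻¹),
        ← ENNReal.ofReal_mul (by positivity), inv_mul_cancel₀ ht0.ne', ENNReal.ofReal_one, one_mul]
    · rw [hF, indicator_of_notMem hz, indicator_of_notMem (hmem.not.2 hz), mul_zero]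
  have hrr : ∀ w : E, (ball (0 : E) r).indicator (fun w ↦ g w * ‖w‖ₑ *
      (Ioi (‖w‖ / r)).indicator (fun s ↦ ENNReal.ofReal (s ^ (-(finrank ℝ E + 1 : ℝ)))) t) w =
      ENNReal.ofReal (t ^ (-(finrank ℝ E + 1 : ℝ))) * F w := by
    intro w
    have hmem : t ∈ Ioi (‖w‖ / r) ↔ w ∈ ball (0 : E) (t * r) := by
      simp [div_lt_iff₀ hr]
    by_cases hw : w ∈ ball (0 : E) (t * r)
    · rw [hF, indicator_of_mem (ball_subset_ball htr hw), indicator_of_mem (hmem.2 hw),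
        indicator_of_mem hw, mul_comm]
    · rw [hF, indicator_of_notMem hw, mul_zero]
      refine indicator_apply_eq_zero.2 fun _ ↦ ?_
      rw [indicator_of_notMem (hmem.not.2 hw), mul_zero]
  rw [← lintegral_indicator measurableSet_ball, ← lintegral_indicator measurableSet_ball,
    lintegral_congr hl, lintegral_congr hrr, lintegral_const_mul _ (by fun_prop),
    lintegral_const_mul _ hFm, lintegral_comp_smul_of_pos μ hFm ht0, ← mul_assoc,
    ← ENNReal.ofReal_mul (by positivity)]
  congr 2
  rw [rpow_neg ht0.le, rpow_add ht0, rpow_natCast, rpow_one, mul_inv, mul_comm]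

/-- Integrating along rays from the origin over a ball is controlled by a Riesz-type potential. -/
lemma setLIntegral_ball_ray_le {g : E → ENNReal} (hg : Measurable g) (hd : finrank ℝ E ≠ 0)
    {r : ℝ} (hr : 0 < r) :
    ∫⁻ z in ball (0 : E) r, (∫⁻ t in Ioo (0 : ℝ) 1, g (t • z) * ‖z‖ₑ) ∂μ ≤
      ENNReal.ofReal (r ^ finrank ℝ E / finrank ℝ E) *
        ∫⁻ z in ball (0 : E) r, g z * ENNReal.ofReal (‖z‖ ^ (finrank ℝ E - 1))⁻¹ ∂μ := by
  have hind : Measurable fun p : ℝ × E ↦ (Ioi (‖p.2‖ / r)).indicator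
      (fun s ↦ ENNReal.ofReal (s ^ (-(finrank ℝ E + 1 : ℝ)))) p.1 := by
    have hs : MeasurableSet {p : ℝ × E | ‖p.2‖ / r < p.1} :=
      measurableSet_lt (by fun_prop) (by fun_prop)
    exact (by fun_prop : Measurable fun p : ℝ × E ↦
      ENNReal.ofReal (p.1 ^ (-(finrank ℝ E + 1 : ℝ)))).indicator hs
  rw [lintegral_lintegral_swap (by fun_prop),
    setLIntegral_congr_fun measurableSet_Ioo fun t ht ↦
      setLIntegral_ball_comp_smul_mul_enorm μ hg hr ht,
    lintegral_lintegral_swap (Measurable.aemeasurable (by fun_prop)),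
    ← lintegral_const_mul _ (by fun_prop)]
  refine lintegral_mono fun w ↦ ?_
  rcases eq_or_ne w 0 with rfl | hw
  · simp
  have hw' : 0 < ‖w‖ := norm_pos_iff.2 hw
  calc ∫⁻ t in Ioo (0 : ℝ) 1, g w * ‖w‖ₑ * (Ioi (‖w‖ / r)).indicator
        (fun s ↦ ENNReal.ofReal (s ^ (-(finrank ℝ E + 1 : ℝ)))) t
      ≤ ∫⁻ t, g w * ‖w‖ₑ * (Ioi (‖w‖ / r)).indicator
        (fun s ↦ ENNReal.ofReal (s ^ (-(finrank ℝ E + 1 : ℝ)))) t := setLIntegral_le_lintegral _ _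
    _ = g w * ENNReal.ofReal (‖w‖ * (((‖w‖ / r) ^ finrank ℝ E)⁻¹ / finrank ℝ E)) := by
      rw [lintegral_const_mul _ ((by fun_prop : Measurable fun s : ℝ ↦
          ENNReal.ofReal (s ^ (-(finrank ℝ E + 1 : ℝ)))).indicator measurableSet_Ioi),
        lintegral_indicator measurableSet_Ioi, setLIntegral_Ioi_rpow_neg hd (by positivity),
        ENNReal.ofReal_mul hw'.le, ofReal_norm, mul_assoc]
    _ = _ := by
      rw [mul_left_comm, ← ENNReal.ofReal_mul (by positivity)]
      congr 2
      obtain ⟨n, hn⟩ := Nat.exists_eq_succ_of_ne_zero hd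
      rw [hn, Nat.succ_sub_one, Nat.succ_eq_add_one, div_pow]
      field_simp
      exact (pow_succ' _ _).symm

lemma setLIntegral_ball_enorm_sub_le {u : E → ℝ} (hu : ContDiff ℝ 1 u) (hd : finrank ℝ E ≠ 0)
    (x : E) {r : ℝ} (hr : 0 < r) :
    ∫⁻ w in ball x r, ‖u w - u x‖ₑ ∂μ ≤
      ENNReal.ofReal (r ^ finrank ℝ E / finrank ℝ E) * ∫⁻ z in ball (0 : E) r,
        ENNReal.ofReal (‖fderiv ℝ u (x + z)‖ / ‖z‖ ^ (finrank ℝ E - 1)) ∂μ := by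
  have hc : Continuous (fderiv ℝ u) := hu.continuous_fderiv one_ne_zero
  have hpre : (fun z ↦ x + z) ⁻¹' ball x r = ball (0 : E) r := by
    ext z; simp
  rw [← (measurePreserving_add_left μ x).setLIntegral_comp_preimage measurableSet_ball
    (by have := hu.continuous; fun_prop), hpre]
  refine (lintegral_mono fun z ↦ enorm_sub_le_lintegral_fderiv hu x z).trans ?_
  refine (setLIntegral_ball_ray_le μ (g := fun z ↦ ‖fderiv ℝ u (x + z)‖ₑ)
    (Continuous.measurable (by fun_prop)) hd hr).trans_eq ?_
  simp_rw [div_eq_mul_inv (‖fderiv ℝ u _‖), ENNReal.ofReal_mul (norm_nonneg _), ofReal_norm]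

lemma integrableOn_ball_norm_fderiv_div {u : E → ℝ} (hu : ContDiff ℝ 1 u)
    (hd : finrank ℝ E ≠ 0) (x : E) (r : ℝ) :
    IntegrableOn (fun z ↦ ‖fderiv ℝ u (x + z)‖ / ‖z‖ ^ (finrank ℝ E - 1)) (ball (0 : E) r) μ := by
  have : Nontrivial E := nontrivial_of_finrank_pos (R := ℝ) (Nat.pos_of_ne_zero hd)
  have hc : Continuous (fderiv ℝ u) := hu.continuous_fderiv one_ne_zero
  have hk : IntegrableOn (fun z : E ↦ (‖z‖ ^ (finrank ℝ E - 1))⁻¹) (ball (0 : E) r) μ := by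
    rw [integrableOn_fun_norm_addHaar μ (f := fun s ↦ (s ^ (finrank ℝ E - 1))⁻¹)]
    refine (integrableOn_const (C := (1 : ℝ)) (by simp)).congr_fun (fun s hs ↦ ?_)
      measurableSet_Ioo
    exact (mul_inv_cancel₀ (pow_pos hs.1 _).ne').symm
  obtain ⟨M, hM⟩ := (isCompact_closedBall (0 : E) r).exists_bound_of_continuousOn
    (f := fun z ↦ fderiv ℝ u (x + z)) (by fun_prop)
  simp_rw [div_eq_mul_inv]
  refine Integrable.bdd_mul (c := M) hk (Continuous.aestronglyMeasurable (by fun_prop)) ?_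
  filter_upwards [ae_restrict_mem measurableSet_ball] with z hz
  simpa using hM z (ball_subset_closedBall hz)

lemma abs_sub_le_integral_fderiv_div {u : E → ℝ} (hu : ContDiff ℝ 1 u)
    (hd : finrank ℝ E ≠ 0) {x y : E} (hxy : x ≠ y) :
    |u x - u y| ≤ 2 ^ finrank ℝ E / (finrank ℝ E * μ.real (ball 0 1)) *
      ((∫ z in ball (0 : E) ‖x - y‖, ‖fderiv ℝ u (x + z)‖ / ‖z‖ ^ (finrank ℝ E - 1) ∂μ) +
        ∫ z in ball (0 : E) ‖x - y‖, ‖fderiv ℝ u (y + z)‖ / ‖z‖ ^ (finrank ℝ E - 1) ∂μ) := by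
  set r := ‖x - y‖
  have hr : 0 < r := norm_pos_iff.2 (sub_ne_zero.2 hxy)
  have hI : ∀ x : E, 0 ≤ ∫ z in ball (0 : E) r,
      ‖fderiv ℝ u (x + z)‖ / ‖z‖ ^ (finrank ℝ E - 1) ∂μ := fun x ↦
    integral_nonneg fun z ↦ by positivity
  have hlint : ∀ x : E, ∫⁻ w in ball x r, ‖u w - u x‖ₑ ∂μ ≤ ENNReal.ofReal
      (r ^ finrank ℝ E / finrank ℝ E * ∫ z in ball (0 : E) r,
        ‖fderiv ℝ u (x + z)‖ / ‖z‖ ^ (finrank ℝ E - 1) ∂μ) := fun x ↦ by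
    rw [ENNReal.ofReal_mul (by positivity), ofReal_integral_eq_lintegral_ofReal
      (integrableOn_ball_norm_fderiv_div μ hu hd x r) (ae_of_all _ fun z ↦ by positivity)]
    exact setLIntegral_ball_enorm_sub_le μ hu hd x hr
  set m := midpoint ℝ x y
  have hmx : ball m (r / 2) ⊆ ball x r := ball_subset_ball' (by
    rw [dist_midpoint_left, dist_eq_norm, Real.norm_ofNat]; linarith)
  have hmy : ball m (r / 2) ⊆ ball y r := ball_subset_ball' (by
    rw [dist_midpoint_right, dist_eq_norm, Real.norm_ofNat]; linarith)
  have hvol : 0 < μ.real (ball (0 : E) 1) :=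
    ENNReal.toReal_pos (measure_ball_pos μ 0 one_pos).ne' measure_ball_lt_top.ne
  have hmain : ENNReal.ofReal (|u x - u y| * ((r / 2) ^ finrank ℝ E * μ.real (ball (0 : E) 1))) ≤
      ENNReal.ofReal (r ^ finrank ℝ E / finrank ℝ E *
        ((∫ z in ball (0 : E) r, ‖fderiv ℝ u (x + z)‖ / ‖z‖ ^ (finrank ℝ E - 1) ∂μ) +
        ∫ z in ball (0 : E) r, ‖fderiv ℝ u (y + z)‖ / ‖z‖ ^ (finrank ℝ E - 1) ∂μ)) := by
    calc _ = ∫⁻ _ in ball m (r / 2), ‖u x - u y‖ₑ ∂μ := by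
          rw [setLIntegral_const, Measure.addHaar_ball_of_pos μ m (by positivity),
            ENNReal.ofReal_mul (abs_nonneg _), ENNReal.ofReal_mul (by positivity),
            ofReal_measureReal measure_ball_lt_top.ne, ← Real.norm_eq_abs, ofReal_norm]
      _ ≤ ∫⁻ w in ball m (r / 2), (‖u w - u x‖ₑ + ‖u w - u y‖ₑ) ∂μ := by
          refine lintegral_mono fun w ↦ ?_
          rw [← enorm_neg (u w - u x), neg_sub, ← sub_add_sub_cancel (u x) (u w) (u y)]
          exact enorm_add_le _ _
      _ = (∫⁻ w in ball m (r / 2), ‖u w - u x‖ₑ ∂μ) + ∫⁻ w in ball m (r / 2), ‖u w - u y‖ₑ ∂μ :=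
          lintegral_add_left (by have := hu.continuous; fun_prop) _
      _ ≤ (∫⁻ w in ball x r, ‖u w - u x‖ₑ ∂μ) + ∫⁻ w in ball y r, ‖u w - u y‖ₑ ∂μ :=
          add_le_add (lintegral_mono_set hmx) (lintegral_mono_set hmy)
      _ ≤ _ := by
          rw [mul_add, ENNReal.ofReal_add (mul_nonneg (by positivity) (hI x))
            (mul_nonneg (by positivity) (hI y))]
          exact add_le_add (hlint x) (hlint y)
  rw [ENNReal.ofReal_le_ofReal_iff (mul_nonneg (by positivity) (add_nonneg (hI x) (hI y))),
    ← le_div_iff₀ (by positivity)] at hmain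
  refine hmain.trans_eq ?_
  rw [div_pow]
  field_simp

end RadialAverage

/-- For `d ≥ 1` there is a constant `C > 0`, depending only on `d`,
such that for every continuously differentiable `u : ℝ^d → ℝ` and all `x ≠ y`,
`|u(x) − u(y)| ≤ C |x−y| (D_{|x−y|} u(x) + D_{|x−y|} u(y))`. -/
theorem lagrange_type_inequality (d : ℕ) (hd : 1 ≤ d) :
    ∃ C : ℝ, 0 < C ∧ ∀ u : EuclideanSpace ℝ (Fin d) → ℝ, ContDiff ℝ 1 u →
      ∀ x y : EuclideanSpace ℝ (Fin d), x ≠ y →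
        |u x - u y| ≤ C * ‖x - y‖ * (Davg d u ‖x - y‖ x + Davg d u ‖x - y‖ y) := by
  have hd' : Module.finrank ℝ (EuclideanSpace ℝ (Fin d)) = d := finrank_euclideanSpace_fin
  have hd0 : Module.finrank ℝ (EuclideanSpace ℝ (Fin d)) ≠ 0 := by omega
  have hvol : 0 < (volume : Measure (EuclideanSpace ℝ (Fin d))).real (Metric.ball 0 1) :=
    ENNReal.toReal_pos (Metric.measure_ball_pos volume 0 one_pos).ne' measure_ball_lt_top.ne
  refine ⟨2 ^ d / (d * (volume : Measure (EuclideanSpace ℝ (Fin d))).real (Metric.ball 0 1)),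
    by positivity, fun u hu x y hxy ↦ ?_⟩
  have hr : ‖x - y‖ ≠ 0 := norm_ne_zero_iff.2 (sub_ne_zero.2 hxy)
  have key := abs_sub_le_integral_fderiv_div volume hu hd0 hxy
  rw [hd'] at key
  refine key.trans_eq ?_
  rw [Davg, Davg, ← mul_add, mul_assoc, ← mul_assoc ‖x - y‖, mul_one_div_cancel hr, one_mul]

end
end

section
/- Let d ≥ 2. There exist constants C > 0 and h₀ ∈ (0,1), depending only on d, such that for every continuously differentiable function u : 𝕋^d → ℝ and every h ∈ (0, h₀) one has ∫_{𝕋^d} (|z|+h)^{−d} ‖ D_{|z|} u(·) − D_{|z|} u(· + z) ‖_{L²(𝕋^d)} dz ≤ C |ln h|^{1/2} ( ‖u‖_{L²(𝕋^d)} + ‖∇u‖_{L²(𝕋^d)} ). -/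
open MeasureTheory Real

noncomputable section

/-- The fundamental domain `[-π,π]^d ⊂ ℝ^d` of the torus. -/
def Box (d : ℕ) : Set (EuclideanSpace ℝ (Fin d)) :=
  {x | ∀ i, x i ∈ Set.Icc (-π) π}

/-- A function `u : ℝ^d → ℝ` is `2π`-periodic in every coordinate, i.e. it is (the
periodic extension of) a function on the torus `𝕋^d = [-π,π]^d`. -/
def TorusPeriodic {d : ℕ} (u : EuclideanSpace ℝ (Fin d) → ℝ) : Prop :=
  ∀ (x : EuclideanSpace ℝ (Fin d)) (m : Fin d → ℤ),
    u (x + (WithLp.equiv 2 (Fin d → ℝ)).symm (fun i => 2 * π * (m i : ℝ))) = u x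

/-- The kernel `|y|^{1-d}` truncated to the unit ball. -/
def truncKernel (d : ℕ) (y : EuclideanSpace ℝ (Fin d)) : ℝ :=
  (Metric.ball (0 : EuclideanSpace ℝ (Fin d)) 1).indicator (fun y => (‖y‖ ^ (d - 1))⁻¹) y

lemma truncKernel_nonneg (d : ℕ) (y : EuclideanSpace ℝ (Fin d)) : 0 ≤ truncKernel d y :=
  Set.indicator_nonneg (fun _ _ => by positivity) y

lemma truncKernel_neg (d : ℕ) (y : EuclideanSpace ℝ (Fin d)) :
    truncKernel d (-y) = truncKernel d y := by
  simp [truncKernel, Set.indicator]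

lemma integrable_truncKernel (d : ℕ) (hd : 2 ≤ d) : Integrable (truncKernel d) := by
  have : Nontrivial (EuclideanSpace ℝ (Fin d)) :=
    Module.nontrivial_of_finrank_pos (R := ℝ) (by simp; omega)
  have h : truncKernel d = fun y => (fun r : ℝ => (Set.Iio 1).indicator
      (fun r => (r ^ (d - 1))⁻¹) r) ‖y‖ := by
    ext y; simp [truncKernel, Set.indicator]
  rw [h, integrable_fun_norm_addHaar volume]
  simp only [finrank_euclideanSpace, Fintype.card_fin]
  have h2 : Set.EqOn (fun r : ℝ => (Set.Iio 1).indicator (fun _ => (1 : ℝ)) r)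
      (fun y : ℝ => y ^ (d - 1) • (Set.Iio 1).indicator (fun r => (r ^ (d - 1))⁻¹) y)
      (Set.Ioi 0) := by
    intro r hr
    have : r ≠ 0 := ne_of_gt hr
    by_cases h1 : r < 1 <;> simp [Set.indicator, h1, this]
  refine IntegrableOn.congr_fun ?_ h2 measurableSet_Ioi
  rw [IntegrableOn, integrable_indicator_iff measurableSet_Iio, IntegrableOn,
    Measure.restrict_restrict measurableSet_Iio]
  exact integrableOn_const (by rw [Set.inter_comm, Set.Ioi_inter_Iio]; simp) (by simp)

/-- A radial integrable majorant for the positive part of the increments of `truncKernel`. -/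
lemma integrable_truncKernel_mul (d : ℕ) (hd : 2 ≤ d) :
    Integrable (fun y : EuclideanSpace ℝ (Fin d) => truncKernel d y *
      ((d - 1 : ℕ) * ‖y‖ ^ (-(1/2) : ℝ) + (1 - ‖y‖) ^ (-(1/2) : ℝ))) := by
  have : Nontrivial (EuclideanSpace ℝ (Fin d)) :=
    Module.nontrivial_of_finrank_pos (R := ℝ) (by simp; omega)
  have h : (fun y : EuclideanSpace ℝ (Fin d) => truncKernel d y *
      ((d - 1 : ℕ) * ‖y‖ ^ (-(1/2) : ℝ) + (1 - ‖y‖) ^ (-(1/2) : ℝ))) =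
      fun y => (fun r : ℝ => (Set.Iio (1 : ℝ)).indicator
      (fun r : ℝ => (r ^ (d - 1))⁻¹ *
        ((d - 1 : ℕ) * r ^ (-(1/2) : ℝ) + (1 - r) ^ (-(1/2) : ℝ))) r) ‖y‖ := by
    ext y; simp [truncKernel, Set.indicator]
  rw [h, integrable_fun_norm_addHaar volume]
  simp only [finrank_euclideanSpace, Fintype.card_fin]
  have h2 : Set.EqOn (fun r : ℝ => (Set.Iio 1).indicator
      (fun r : ℝ => (d - 1 : ℕ) * r ^ (-(1/2) : ℝ) + (1 - r) ^ (-(1/2) : ℝ)) r)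
      (fun y : ℝ => y ^ (d - 1) • (Set.Iio (1 : ℝ)).indicator (fun r : ℝ => (r ^ (d - 1))⁻¹ *
        ((d - 1 : ℕ) * r ^ (-(1/2) : ℝ) + (1 - r) ^ (-(1/2) : ℝ))) y)
      (Set.Ioi 0) := by
    intro r hr
    have : r ≠ 0 := ne_of_gt hr
    by_cases h1 : r < 1 <;> simp [Set.indicator, h1]
    field_simp
  refine IntegrableOn.congr_fun ?_ h2 measurableSet_Ioi
  rw [IntegrableOn, integrable_indicator_iff measurableSet_Iio, IntegrableOn,
    Measure.restrict_restrict measurableSet_Iio, Set.inter_comm, Set.Ioi_inter_Iio]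
  have i1 : IntervalIntegrable (fun r : ℝ => r ^ (-(1/2) : ℝ)) volume 0 1 :=
    intervalIntegral.intervalIntegrable_rpow' (by norm_num)
  have i2 : IntervalIntegrable (fun r : ℝ => (1 - r) ^ (-(1/2) : ℝ)) volume 0 1 := by
    simpa using (i1.comp_sub_left 1).symm
  have i3 := (i1.const_mul ((d - 1 : ℕ) : ℝ)).add i2
  rw [intervalIntegrable_iff_integrableOn_Ioo_of_le zero_le_one] at i3
  exact i3

/-- Pointwise bound on the positive part of the increments of `truncKernel`. -/
lemma truncKernel_sub_le (d : ℕ) (a y : EuclideanSpace ℝ (Fin d))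
    (hy : y ≠ 0) (hya : y ≠ a) :
    max (truncKernel d y - truncKernel d (y - a)) 0 ≤ √‖a‖ * (truncKernel d y *
      ((d - 1 : ℕ) * ‖y‖ ^ (-(1/2) : ℝ) + (1 - ‖y‖) ^ (-(1/2) : ℝ))) := by
  have hK := truncKernel_nonneg d y
  have hr : 0 < ‖y‖ := norm_pos_iff.2 hy
  have hs : 0 < ‖y - a‖ := norm_pos_iff.2 (sub_ne_zero.2 hya)
  have hsr : ‖y - a‖ ≤ ‖y‖ + ‖a‖ := norm_sub_le y a
  have hα := norm_nonneg a
  by_cases h1 : ‖y‖ < 1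
  swap
  · have : truncKernel d y = 0 := by simp [truncKernel, h1]
    rw [this]; simp [truncKernel_nonneg]
  have hK1 : truncKernel d y = (‖y‖ ^ (d - 1))⁻¹ := by simp [truncKernel, h1]
  set r := ‖y‖
  set α := ‖a‖
  set s := ‖y - a‖
  have hp1 : 0 ≤ r ^ (-(1/2) : ℝ) := by positivity
  have hp2 : 0 ≤ (1 - r) ^ (-(1/2) : ℝ) := rpow_nonneg (by linarith) _
  have hrhs : 0 ≤ √α * (truncKernel d y *
      ((d - 1 : ℕ) * r ^ (-(1/2) : ℝ) + (1 - r) ^ (-(1/2) : ℝ))) := by positivity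
  refine max_le ?_ hrhs
  have hneg (t : ℝ) (ht : 0 < t) : t ^ (-(1/2) : ℝ) = (√t)⁻¹ := by
    rw [rpow_neg ht.le, sqrt_eq_rpow]
  by_cases h2 : s < 1
  · have hK2 : truncKernel d (y - a) = (s ^ (d - 1))⁻¹ := by
      simp [truncKernel, s, h2]
    have key : 1 - (d - 1 : ℕ) * (√α * (√r)⁻¹) ≤ (r / (r + α)) ^ (d - 1) := by
      have hb := one_add_mul_le_pow (a := -(α / (r + α))) (by
        have : α / (r + α) ≤ 1 := (div_le_one (by positivity)).2 (by linarith)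
        linarith) (d - 1)
      have e : 1 + -(α / (r + α)) = r / (r + α) := by field_simp; ring
      rw [e] at hb
      have : α / (r + α) ≤ √α * (√r)⁻¹ := by
        have h3 : α / (r + α) ≤ √(α / (r + α)) := by
          apply le_sqrt_of_sq_le
          have h0 : 0 ≤ α / (r + α) := by positivity
          have h1 : α / (r + α) ≤ 1 := (div_le_one (by positivity)).2 (by linarith)
          nlinarith
        have h4 : √(α / (r + α)) ≤ √(α / r) := sqrt_le_sqrt (by gcongr; linarith)
        have h5 : √(α / r) = √α * (√r)⁻¹ := by rw [sqrt_div hα, div_eq_mul_inv]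
        linarith
      have := mul_le_mul_of_nonneg_left this (Nat.cast_nonneg (α := ℝ) (d - 1))
      linarith
    have h5 : (r ^ (d - 1))⁻¹ * (r / (r + α)) ^ (d - 1) ≤ (s ^ (d - 1))⁻¹ := by
      rw [div_pow, ← mul_div_assoc, inv_mul_cancel₀ (by positivity), one_div]
      gcongr
    have h6 := mul_le_mul_of_nonneg_left key hK
    rw [hK1] at h6
    rw [hK1, hK2, hneg r hr]
    have h7 : 0 ≤ √α * ((r ^ (d - 1))⁻¹ * (1 - r) ^ (-(1/2) : ℝ)) := by positivity
    nlinarith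
  · have hK2 : truncKernel d (y - a) = 0 := by
      simp [truncKernel, s, h2]
    rw [hK2, sub_zero]
    have h3 : 1 ≤ √α * (1 - r) ^ (-(1/2) : ℝ) := by
      rw [hneg _ (by linarith), ← div_eq_mul_inv, one_le_div (by apply sqrt_pos.2; linarith)]
      exact sqrt_le_sqrt (by linarith)
    have h7 : 0 ≤ √α * (truncKernel d y * ((d - 1 : ℕ) * r ^ (-(1/2) : ℝ))) := by positivity
    nlinarith

/-- The `L¹` modulus of continuity of `truncKernel` is at most of order `1/2`. -/
lemma exists_integral_abs_truncKernel_sub_le (d : ℕ) (hd : 2 ≤ d) :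
    ∃ C : ℝ, 0 ≤ C ∧ ∀ a : EuclideanSpace ℝ (Fin d),
      ∫ y, |truncKernel d y - truncKernel d (y - a)| ≤ C * √‖a‖ := by
  have : Nontrivial (EuclideanSpace ℝ (Fin d)) :=
    Module.nontrivial_of_finrank_pos (R := ℝ) (by simp; omega)
  set g : EuclideanSpace ℝ (Fin d) → ℝ := fun y => truncKernel d y *
      ((d - 1 : ℕ) * ‖y‖ ^ (-(1/2) : ℝ) + (1 - ‖y‖) ^ (-(1/2) : ℝ))
  have hg : Integrable g := integrable_truncKernel_mul d hd
  have hK := integrable_truncKernel d hd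
  have hae (a : EuclideanSpace ℝ (Fin d)) : ∀ᵐ y,
      max (truncKernel d y - truncKernel d (y - a)) 0 ≤ √‖a‖ * g y := by
    filter_upwards [Measure.ae_ne volume 0, Measure.ae_ne volume a] with y h1 h2
    exact truncKernel_sub_le d a y h1 h2
  refine ⟨2 * |∫ y, g y|, by positivity, fun a => ?_⟩
  have hKa : Integrable (fun y => truncKernel d (y - a)) := hK.comp_sub_right a
  have hD : Integrable (fun y => truncKernel d y - truncKernel d (y - a)) := hK.sub hKa
  have e : ∀ x : ℝ, |x| = 2 * max x 0 - x := by
    intro x; rcases le_total 0 x with h | h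
    · rw [abs_of_nonneg h, max_eq_left h]; ring
    · rw [abs_of_nonpos h, max_eq_right h]; ring
  simp_rw [e (truncKernel d _ - _)]
  have hP : Integrable (fun y => max (truncKernel d y - truncKernel d (y - a)) 0) := hD.pos_part
  rw [integral_sub (hP.const_mul 2) hD, integral_sub hK hKa, integral_sub_right_eq_self, sub_self,
    sub_zero, integral_const_mul]
  have := integral_mono_ae hP (hg.const_mul _) (hae a)
  rw [integral_const_mul] at this
  have h3 := mul_le_mul_of_nonneg_left (le_abs_self (∫ y, g y)) (sqrt_nonneg ‖a‖)
  nlinarith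
lemma isCompact_Box (d : ℕ) : IsCompact (Box d) := by
  have h : IsCompact (Set.univ.pi fun _ : Fin d => Set.Icc (-π) π) :=
    isCompact_univ_pi fun _ => isCompact_Icc
  have h2 := h.image (PiLp.continuous_toLp 2 (fun _ : Fin d => ℝ))
  convert h2 using 1
  ext x
  constructor
  · intro hx
    exact ⟨WithLp.ofLp x, fun i _ => hx i, rfl⟩
  · rintro ⟨y, hy, rfl⟩ i
    exact hy i trivial

/-- The weight `(|z|+h)^{-d}` has mass `O(|log h|)` on bounded sets. -/
lemma exists_integral_weight_le (d : ℕ) (hd : 2 ≤ d) {s : Set (EuclideanSpace ℝ (Fin d))}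
    (hs : IsCompact s) :
    ∃ C : ℝ, 0 < C ∧ ∀ h ∈ Set.Ioo (0 : ℝ) (1 / 2),
      ∫ z in s, ((‖z‖ + h) ^ d)⁻¹ ≤ C * |log h| := by
  have : Nontrivial (EuclideanSpace ℝ (Fin d)) :=
    Module.nontrivial_of_finrank_pos (R := ℝ) (by simp; omega)
  obtain ⟨R, hR0, hR⟩ := hs.isBounded.subset_closedBall_lt 0 0
  set σ : ℝ := d * volume.real (Metric.ball (0 : EuclideanSpace ℝ (Fin d)) 1)
  have hσ : 0 ≤ σ := by positivity
  have hlog2 : 0 < log 2 := log_pos (by norm_num)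
  have hlogR : 0 < log (R + 1) := log_pos (by linarith)
  refine ⟨σ * (log (R + 1) / log 2 + 1) + 1, by positivity, fun h hh => ?_⟩
  obtain ⟨h0, h1⟩ := hh
  have hcont : Continuous fun z : EuclideanSpace ℝ (Fin d) => ((‖z‖ + h) ^ d)⁻¹ :=
    Continuous.inv₀ (by fun_prop) (fun z => by positivity)
  have hA : ∫ z in s, ((‖z‖ + h) ^ d)⁻¹ ≤
      ∫ z in Metric.closedBall (0 : EuclideanSpace ℝ (Fin d)) R, ((‖z‖ + h) ^ d)⁻¹ :=
    setIntegral_mono_set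
      (hcont.continuousOn.integrableOn_compact (isCompact_closedBall _ _))
      (Filter.Eventually.of_forall fun z => by positivity) hR.eventuallyLE
  have hB : ∫ z in Metric.closedBall (0 : EuclideanSpace ℝ (Fin d)) R, ((‖z‖ + h) ^ d)⁻¹ =
      σ * ∫ r in Set.Ioc 0 R, r ^ (d - 1) * ((r + h) ^ d)⁻¹ := by
    have e : ∀ z : EuclideanSpace ℝ (Fin d),
        (Metric.closedBall (0 : EuclideanSpace ℝ (Fin d)) R).indicator
          (fun z => ((‖z‖ + h) ^ d)⁻¹) z =
        (fun r : ℝ => (Set.Iic R).indicator (fun r => ((r + h) ^ d)⁻¹) r) ‖z‖ := by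
      intro z; simp [Set.indicator]
    rw [← integral_indicator Metric.isClosed_closedBall.measurableSet]
    simp_rw [e]
    rw [integral_fun_norm_addHaar volume]
    simp only [finrank_euclideanSpace, Fintype.card_fin, nsmul_eq_mul, smul_eq_mul]
    rw [← mul_assoc]
    congr 1
    rw [← Set.Ioi_inter_Iic, Set.inter_comm,
      ← Measure.restrict_restrict measurableSet_Iic, ← integral_indicator measurableSet_Iic]
    congr 1
    ext r
    by_cases hr : r ≤ R <;> simp [Set.indicator, hr]
  have hC : ∫ r in Set.Ioc 0 R, r ^ (d - 1) * ((r + h) ^ d)⁻¹ ≤ ∫ r in Set.Ioc 0 R, (r + h)⁻¹ := by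
    apply setIntegral_mono_on
    · refine (ContinuousOn.integrableOn_Icc ?_).mono_set Set.Ioc_subset_Icc_self
      refine ContinuousOn.mul (by fun_prop) (ContinuousOn.inv₀ (by fun_prop) fun r hr => ?_)
      have := hr.1
      positivity
    · refine (ContinuousOn.integrableOn_Icc ?_).mono_set Set.Ioc_subset_Icc_self
      refine ContinuousOn.inv₀ (by fun_prop) fun r hr => ?_
      have := hr.1
      positivity
    · exact measurableSet_Ioc
    · intro r hr
      have hr0 := hr.1
      obtain ⟨n, rfl⟩ : ∃ n, d = n + 1 := ⟨d - 1, by omega⟩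
      rw [pow_succ, mul_inv, ← mul_assoc, Nat.add_sub_cancel]
      have : r ^ n * ((r + h) ^ n)⁻¹ ≤ 1 := by
        rw [← div_eq_mul_inv, div_le_one (by positivity)]
        gcongr; linarith
      have h3 : 0 ≤ (r + h)⁻¹ := by positivity
      nlinarith
  have hD : ∫ r in Set.Ioc 0 R, (r + h)⁻¹ = log ((R + h) / h) := by
    rw [← intervalIntegral.integral_of_le hR0.le,
      intervalIntegral.integral_comp_add_right (fun x => x⁻¹) h, zero_add,
      integral_inv_of_pos h0 (by linarith)]
  have hE : log ((R + h) / h) ≤ (log (R + 1) / log 2 + 1) * |log h| := by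
    have hl : log h < -log 2 := by
      have := log_lt_log h0 h1
      rwa [one_div, log_inv] at this
    rw [log_div (by positivity) h0.ne', abs_of_neg (by linarith)]
    have h3 : log (R + h) ≤ log (R + 1) := log_le_log (by linarith) (by linarith)
    have h4 : log (R + 1) / log 2 * log 2 ≤ log (R + 1) / log 2 * (-log h) := by
      gcongr; linarith
    rw [div_mul_cancel₀ _ hlog2.ne'] at h4
    linarith
  calc _ ≤ _ := hA
    _ ≤ σ * ((log (R + 1) / log 2 + 1) * |log h|) := by
        rw [hB]; gcongr; exact hC.trans (hD.le.trans hE)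
    _ ≤ _ := by nlinarith [abs_nonneg (log h)]

/-- The scale-invariant almost-orthogonality factor `min((r/s)^{1/2}, (s/r)^{1/2})`. -/
def scaleRatio (s r : ℝ) : ℝ := min √(r / s) √(s / r)

lemma scaleRatio_nonneg (s r : ℝ) : 0 ≤ scaleRatio s r := by
  unfold scaleRatio; positivity

lemma scaleRatio_comm (s r : ℝ) : scaleRatio s r = scaleRatio r s := by
  unfold scaleRatio; rw [min_comm]

lemma scaleRatio_le_one (s r : ℝ) : scaleRatio s r ≤ 1 := by
  unfold scaleRatio
  by_contra! h
  rw [lt_min_iff, lt_sqrt zero_le_one, lt_sqrt zero_le_one, one_pow] at h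
  have h1 : r / s * (s / r) ≤ 1 := by
    by_cases hs : s = 0
    · simp [hs]
    by_cases hr : r = 0
    · simp [hr]
    field_simp; rfl
  nlinarith

lemma measurable_scaleRatio : Measurable fun p : ℝ × ℝ => scaleRatio p.1 p.2 := by
  unfold scaleRatio; fun_prop

lemma integrable_scaleRatio (d : ℕ) (hd : 2 ≤ d) :
    Integrable fun w : EuclideanSpace ℝ (Fin d) => (‖w‖ ^ d)⁻¹ * scaleRatio 1 ‖w‖ := by
  have : Nontrivial (EuclideanSpace ℝ (Fin d)) :=
    Module.nontrivial_of_finrank_pos (R := ℝ) (by simp; omega)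
  rw [integrable_fun_norm_addHaar volume (f := fun r => (r ^ d)⁻¹ * scaleRatio 1 r)]
  simp only [finrank_euclideanSpace, Fintype.card_fin, smul_eq_mul]
  have hm : Measurable fun r : ℝ => r ^ (d - 1) * ((r ^ d)⁻¹ * scaleRatio 1 r) := by
    unfold scaleRatio; fun_prop
  have key : ∀ r : ℝ, 0 < r → r ^ (d - 1) * ((r ^ d)⁻¹ * scaleRatio 1 r) =
      r⁻¹ * scaleRatio 1 r := by
    intro r hr
    obtain ⟨n, rfl⟩ : ∃ n, d = n + 1 := ⟨d - 1, by omega⟩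
    rw [pow_succ, Nat.add_sub_cancel]
    field_simp
  have e1 : ∀ r : ℝ, 0 < r → r⁻¹ * √(r / 1) = r ^ (-(1/2) : ℝ) := by
    intro r hr
    rw [div_one, sqrt_eq_rpow, ← rpow_neg_one, ← rpow_add hr]; norm_num
  have e2 : ∀ r : ℝ, 0 < r → r⁻¹ * √(1 / r) = r ^ (-(3/2) : ℝ) := by
    intro r hr
    rw [one_div, sqrt_inv, sqrt_eq_rpow, ← rpow_neg hr.le, ← rpow_neg_one, ← rpow_add hr]; norm_num
  have hnn : ∀ r : ℝ, 0 < r → ‖r ^ (d - 1) * ((r ^ d)⁻¹ * scaleRatio 1 r)‖ =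
      r⁻¹ * scaleRatio 1 r := by
    intro r hr
    rw [key r hr, norm_of_nonneg (mul_nonneg (by positivity) (scaleRatio_nonneg _ _))]
  rw [← Set.Ioc_union_Ioi_eq_Ioi (zero_le_one (α := ℝ))]
  refine IntegrableOn.union ?_ ?_
  · have i1 : IntervalIntegrable (fun r : ℝ => r ^ (-(1/2) : ℝ)) volume 0 1 :=
      intervalIntegral.intervalIntegrable_rpow' (by norm_num)
    rw [intervalIntegrable_iff_integrableOn_Ioc_of_le zero_le_one] at i1
    refine Integrable.mono' i1 hm.aestronglyMeasurable ?_
    filter_upwards [ae_restrict_mem measurableSet_Ioc] with r hr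
    rw [hnn r hr.1, ← e1 r hr.1]
    have := hr.1
    unfold scaleRatio
    gcongr
    exact min_le_left _ _
  · have i1 : IntegrableOn (fun r : ℝ => r ^ (-(3/2) : ℝ)) (Set.Ioi 1) :=
      integrableOn_Ioi_rpow_of_lt (by norm_num) one_pos
    refine Integrable.mono' i1 hm.aestronglyMeasurable ?_
    filter_upwards [ae_restrict_mem measurableSet_Ioi] with r hr
    have h0 : 0 < r := lt_trans one_pos hr
    rw [hnn r h0, ← e2 r h0]
    unfold scaleRatio
    gcongr
    exact min_le_right _ _

/-- Schur-type bound for `scaleRatio` against the weight `(|w|+h)^{-d}`. -/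
lemma exists_integral_weight_scaleRatio_le (d : ℕ) (hd : 2 ≤ d)
    (s : Set (EuclideanSpace ℝ (Fin d))) :
    ∃ L : ℝ, 0 ≤ L ∧ ∀ h : ℝ, 0 < h → ∀ t : ℝ, 0 ≤ t →
      ∫ w in s, ((‖w‖ + h) ^ d)⁻¹ * scaleRatio t ‖w‖ ≤ L := by
  have hφ := integrable_scaleRatio d hd
  have hφ0 : ∀ w : EuclideanSpace ℝ (Fin d), 0 ≤ (‖w‖ ^ d)⁻¹ * scaleRatio 1 ‖w‖ :=
    fun w => mul_nonneg (by positivity) (scaleRatio_nonneg _ _)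
  refine ⟨∫ w : EuclideanSpace ℝ (Fin d), (‖w‖ ^ d)⁻¹ * scaleRatio 1 ‖w‖, integral_nonneg hφ0,
    fun h hh t ht => ?_⟩
  rcases ht.eq_or_lt with rfl | ht
  · have : ∀ r, scaleRatio 0 r = 0 := by intro r; simp [scaleRatio]
    simp only [this, mul_zero, integral_zero]
    exact integral_nonneg hφ0
  set ψ : EuclideanSpace ℝ (Fin d) → ℝ :=
    fun w => (t ^ d)⁻¹ * ((‖t⁻¹ • w‖ ^ d)⁻¹ * scaleRatio 1 ‖t⁻¹ • w‖)
  have hψ : Integrable ψ := (hφ.comp_smul (inv_ne_zero ht.ne')).const_mul _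
  have hψ0 : ∀ w, 0 ≤ ψ w := fun w => mul_nonneg (by positivity) (hφ0 _)
  have hscale : ∫ w, ψ w = ∫ w : EuclideanSpace ℝ (Fin d), (‖w‖ ^ d)⁻¹ * scaleRatio 1 ‖w‖ := by
    simp only [ψ]
    rw [integral_const_mul, Measure.integral_comp_inv_smul_of_nonneg volume
      (fun w : EuclideanSpace ℝ (Fin d) => (‖w‖ ^ d)⁻¹ * scaleRatio 1 ‖w‖) ht.le]
    simp only [finrank_euclideanSpace, Fintype.card_fin, smul_eq_mul]
    rw [← mul_assoc, inv_mul_cancel₀ (by positivity), one_mul]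
  have hle : ∀ w : EuclideanSpace ℝ (Fin d), ((‖w‖ + h) ^ d)⁻¹ * scaleRatio t ‖w‖ ≤ ψ w := by
    intro w
    rcases eq_or_ne w 0 with rfl | hw
    · simp [ψ, scaleRatio]
    have hw0 : 0 < ‖w‖ := norm_pos_iff.2 hw
    have e1 : scaleRatio 1 ‖t⁻¹ • w‖ = scaleRatio t ‖w‖ := by
      simp only [scaleRatio, norm_smul, norm_inv, norm_of_nonneg ht.le]
      congr 2 <;> field_simp
    have e2 : (t ^ d)⁻¹ * (‖t⁻¹ • w‖ ^ d)⁻¹ = (‖w‖ ^ d)⁻¹ := by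
      rw [norm_smul, norm_inv, norm_of_nonneg ht.le, mul_pow, inv_pow, mul_inv, inv_inv,
        ← mul_assoc, inv_mul_cancel₀ (by positivity), one_mul]
    simp only [ψ]
    rw [← mul_assoc, e1, e2]
    refine mul_le_mul_of_nonneg_right ?_ (scaleRatio_nonneg _ _)
    gcongr
    linarith
  calc _ ≤ ∫ w in s, ψ w :=
        integral_mono_of_nonneg
          (Filter.Eventually.of_forall fun w => mul_nonneg (by positivity) (scaleRatio_nonneg _ _))
          hψ.integrableOn (Filter.Eventually.of_forall hle)
    _ ≤ ∫ w, ψ w := setIntegral_le_integral hψ (Filter.Eventually.of_forall hψ0)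
    _ = _ := hscale
open scoped InnerProductSpace in
/-- Continuous Cotlar–Stein estimate for a family of operators `T z` with adjoints
`T' z`: an almost-orthogonality bound `‖T w (T' z v)‖ ≤ M m(z,w) ‖v‖` with a Schur-bounded
symmetric kernel `m` controls the square function. -/
lemma integral_norm_sq_le_of_almost_orthogonal {Z H : Type*} [MeasurableSpace Z]
    [NormedAddCommGroup H] [InnerProductSpace ℝ H] [CompleteSpace H]
    (ν : Measure Z) [IsFiniteMeasure ν] (T T' : Z → H →L[ℝ] H) (m : Z → Z → ℝ) (M L B : ℝ)
    (hM : 0 ≤ M) (hL0 : 0 ≤ L)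
    (hadj : ∀ z a b, ⟪T z a, b⟫_ℝ = ⟪a, T' z b⟫_ℝ)
    (hbound : ∀ z w v, ‖T w (T' z v)‖ ≤ M * m z w * ‖v‖)
    (hm0 : ∀ z w, 0 ≤ m z w) (hm1 : ∀ z w, m z w ≤ 1) (hmsymm : ∀ z w, m z w = m w z)
    (hmmeas : Measurable fun p : Z × Z => m p.1 p.2)
    (hL : ∀ z, ∫ w, m z w ∂ν ≤ L) (v : H)
    (hT : StronglyMeasurable fun z => T z v) (hT' : StronglyMeasurable fun z => T' z (T z v))
    (hB : ∀ z, ‖T z v‖ ≤ B) (hB' : ∀ z, ‖T' z (T z v)‖ ≤ B) :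
    ∫ z, ‖T z v‖ ^ 2 ∂ν ≤ M * L * ‖v‖ ^ 2 := by
  set t : Z → ℝ := fun z => ‖T z v‖ with ht
  have htm : Measurable t := hT.norm.measurable
  have ht0 : ∀ z, 0 ≤ t z := fun z => norm_nonneg _
  have htsq : ∀ z, ‖t z ^ 2‖ ≤ B ^ 2 := fun z => by
    rw [norm_of_nonneg (by positivity)]
    exact pow_le_pow_left₀ (ht0 z) (hB z) 2
  have hI : Integrable (fun z => t z ^ 2) ν :=
    .of_bound (htm.pow_const 2).aestronglyMeasurable (B ^ 2) (.of_forall htsq)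
  have hG : Integrable (fun z => T' z (T z v)) ν :=
    .of_bound hT'.aestronglyMeasurable B (.of_forall hB')
  set S : H := ∫ z, T' z (T z v) ∂ν with hS
  have hIS : ∫ z, t z ^ 2 ∂ν = ⟪v, S⟫_ℝ := by
    rw [hS, ← integral_inner hG v]
    congr 1; ext z
    rw [← hadj, real_inner_self_eq_norm_sq]
  have hcross (z w : Z) : ⟪T' z (T z v), T' w (T w v)⟫_ℝ ≤
      M / 2 * (m z w * t z ^ 2 + m z w * t w ^ 2) := by
    have h1 : ⟪T' z (T z v), T' w (T w v)⟫_ℝ = ⟪T w (T' z (T z v)), T w v⟫_ℝ := (hadj _ _ _).symm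
    have h2 := real_inner_le_norm (T w (T' z (T z v))) (T w v)
    have h3 := mul_le_mul_of_nonneg_right (hbound z w (T z v)) (norm_nonneg (T w v))
    have h4 : 0 ≤ M * m z w := mul_nonneg hM (hm0 z w)
    have h5 : 0 ≤ M * m z w * (t z - t w) ^ 2 := by positivity
    rw [h1]
    simp only [ht] at h5 ⊢
    nlinarith
  have hprod : Integrable (fun p : Z × Z => m p.1 p.2 * t p.1 ^ 2) (ν.prod ν) := by
    refine .of_bound (Measurable.aestronglyMeasurable (by fun_prop)) (B ^ 2) (.of_forall fun p => ?_)
    rw [norm_mul, norm_of_nonneg (hm0 _ _)]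
    have := htsq p.1
    nlinarith [hm1 p.1 p.2, hm0 p.1 p.2, norm_nonneg (t p.1 ^ 2)]
  have hprod' : Integrable (fun p : Z × Z => m p.1 p.2 * t p.2 ^ 2) (ν.prod ν) := by
    refine .of_bound (Measurable.aestronglyMeasurable (by fun_prop)) (B ^ 2) (.of_forall fun p => ?_)
    rw [norm_mul, norm_of_nonneg (hm0 _ _)]
    have := htsq p.2
    nlinarith [hm1 p.1 p.2, hm0 p.1 p.2, norm_nonneg (t p.2 ^ 2)]
  have hsec1 (z : Z) : Integrable (fun w => m z w * t z ^ 2) ν := by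
    refine (Integrable.of_bound (hmmeas.comp measurable_prodMk_left).aestronglyMeasurable 1
      (.of_forall fun w => ?_)).mul_const _
    rw [Function.comp_apply, norm_of_nonneg (hm0 _ _)]
    exact hm1 _ _
  have hsec2 (z : Z) : Integrable (fun w => m z w * t w ^ 2) ν := by
    refine hI.bdd_mul (c := 1) (hmmeas.comp measurable_prodMk_left).aestronglyMeasurable
      (.of_forall fun w => ?_)
    rw [norm_of_nonneg (hm0 _ _)]
    exact hm1 _ _
  have hone : ∫ z, ∫ w, m z w * t z ^ 2 ∂ν ∂ν ≤ L * ∫ z, t z ^ 2 ∂ν := by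
    rw [← integral_const_mul]
    refine integral_mono hprod.integral_prod_left (hI.const_mul L) fun z => ?_
    simp only
    rw [integral_mul_const]
    exact mul_le_mul_of_nonneg_right (hL z) (by positivity)
  have htwo : ∫ z, ∫ w, m z w * t w ^ 2 ∂ν ∂ν ≤ L * ∫ z, t z ^ 2 ∂ν := by
    rw [integral_integral_swap hprod']
    refine le_trans (le_of_eq ?_) hone
    congr 1; ext z; congr 1; ext w; rw [hmsymm]
  have hSS : ‖S‖ ^ 2 ≤ M * L * ∫ z, t z ^ 2 ∂ν := by
    have e : ‖S‖ ^ 2 = ∫ z, ⟪S, T' z (T z v)⟫_ℝ ∂ν := by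
      rw [integral_inner hG S, real_inner_self_eq_norm_sq]
    have e2 (z : Z) : ⟪S, T' z (T z v)⟫_ℝ ≤
        ∫ w, M / 2 * (m z w * t z ^ 2 + m z w * t w ^ 2) ∂ν := by
      rw [real_inner_comm, hS, ← integral_inner hG]
      exact integral_mono (hG.const_inner _) (((hsec1 z).add (hsec2 z)).const_mul _)
        fun w => hcross z w
    rw [e]
    calc _ ≤ ∫ z, ∫ w, M / 2 * (m z w * t z ^ 2 + m z w * t w ^ 2) ∂ν ∂ν :=
          integral_mono (hG.const_inner S)
            ((hprod.add hprod').const_mul (M / 2)).integral_prod_left e2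
      _ = M / 2 * (∫ z, ∫ w, m z w * t z ^ 2 ∂ν ∂ν + ∫ z, ∫ w, m z w * t w ^ 2 ∂ν ∂ν) := by
          rw [← integral_add hprod.integral_prod_left hprod'.integral_prod_left,
            ← integral_const_mul]
          congr 1; ext z
          rw [integral_const_mul, integral_add (hsec1 z) (hsec2 z)]
      _ ≤ M / 2 * (L * ∫ z, t z ^ 2 ∂ν + L * ∫ z, t z ^ 2 ∂ν) := by gcongr
      _ = _ := by ring
  have hI0 : 0 ≤ ∫ z, t z ^ 2 ∂ν := integral_nonneg fun z => by positivity
  have hCS : (∫ z, t z ^ 2 ∂ν) ≤ ‖v‖ * ‖S‖ := hIS ▸ real_inner_le_norm v S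
  change ∫ z, t z ^ 2 ∂ν ≤ _
  set I := ∫ z, t z ^ 2 ∂ν
  rcases hI0.eq_or_lt with h0 | h0
  · rw [← h0]; positivity
  · have h1 : I ^ 2 ≤ (‖v‖ * ‖S‖) ^ 2 := pow_le_pow_left₀ hI0 hCS 2
    have h2 : I * I ≤ (M * L * ‖v‖ ^ 2) * I := by
      have := mul_le_mul_of_nonneg_left hSS (sq_nonneg ‖v‖)
      nlinarith
    exact le_of_mul_le_mul_right h2 h0
/-- A strongly continuous isometric representation of `ℝ^d` on a real Hilbert space. -/
structure TranslationRep (d : ℕ) (H : Type*) [NormedAddCommGroup H] [InnerProductSpace ℝ H] where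
  /-- The isometry attached to a translation vector. -/
  trans : EuclideanSpace ℝ (Fin d) → H →ₗᵢ[ℝ] H
  trans_zero : ∀ v, trans 0 v = v
  trans_add : ∀ x y v, trans (x + y) v = trans x (trans y v)
  continuous_trans : ∀ v, Continuous fun y => trans y v

namespace TranslationRep

variable {d : ℕ} {H : Type*} [NormedAddCommGroup H] [InnerProductSpace ℝ H]

lemma trans_comm (U : TranslationRep d H) (x y : EuclideanSpace ℝ (Fin d)) (v : H) :
    U.trans x (U.trans y v) = U.trans y (U.trans x v) := by
  rw [← U.trans_add, ← U.trans_add, add_comm]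

open scoped InnerProductSpace in
lemma inner_trans (U : TranslationRep d H) (x : EuclideanSpace ℝ (Fin d)) (a b : H) :
    ⟪U.trans x a, b⟫_ℝ = ⟪a, U.trans (-x) b⟫_ℝ := by
  rw [← (U.trans x).inner_map_map a, ← U.trans_add, add_neg_cancel, U.trans_zero]

lemma continuous_trans_prod (U : TranslationRep d H) :
    Continuous fun p : EuclideanSpace ℝ (Fin d) × H => U.trans p.1 p.2 :=
  continuous_prod_of_continuous_lipschitzWith' _ 1
    (fun x => (U.trans x).isometry.lipschitz) U.continuous_trans

variable {k : EuclideanSpace ℝ (Fin d) → ℝ}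

lemma integrable_smul_trans (U : TranslationRep d H) (hk : Integrable k) (r : ℝ) (v : H) :
    Integrable fun y => k y • U.trans (r • y) v := by
  have hc : Continuous fun y : EuclideanSpace ℝ (Fin d) => U.trans (r • y) v :=
    (U.continuous_trans v).comp (by fun_prop)
  refine Integrable.mono' (hk.norm.mul_const ‖v‖) (hk.1.smul hc.aestronglyMeasurable)
    (.of_forall fun y => ?_)
  rw [norm_smul, LinearIsometry.norm_map]

/-- The dilated average `v ↦ ∫ k(y) U_{ry} v dy`. -/
def avg (U : TranslationRep d H) (hk : Integrable k) (r : ℝ) : H →L[ℝ] H :=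
  LinearMap.mkContinuous
    { toFun := fun v => ∫ y, k y • U.trans (r • y) v
      map_add' := fun v w => by
        simp only [map_add, smul_add]
        exact integral_add (U.integrable_smul_trans hk r v) (U.integrable_smul_trans hk r w)
      map_smul' := fun c v => by
        simp only [map_smul, RingHom.id_apply]
        rw [← integral_smul]
        simp_rw [smul_comm c] }
    (∫ y, |k y|) fun v => by
      refine (norm_integral_le_integral_norm _).trans ?_
      rw [← integral_mul_const]
      simp [norm_smul]

lemma avg_apply (U : TranslationRep d H) (hk : Integrable k) (r : ℝ) (v : H) :
    U.avg hk r v = ∫ y, k y • U.trans (r • y) v := rfl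

lemma norm_avg_apply_le (U : TranslationRep d H) (hk : Integrable k) (r : ℝ) (v : H) :
    ‖U.avg hk r v‖ ≤ (∫ y, |k y|) * ‖v‖ := by
  rw [avg_apply]
  refine (norm_integral_le_integral_norm _).trans ?_
  rw [← integral_mul_const]
  simp [norm_smul]

lemma trans_avg [CompleteSpace H] (U : TranslationRep d H) (hk : Integrable k) (r : ℝ)
    (x : EuclideanSpace ℝ (Fin d)) (v : H) :
    U.trans x (U.avg hk r v) = U.avg hk r (U.trans x v) := by
  have := (U.trans x).toContinuousLinearMap.integral_comp_comm (U.integrable_smul_trans hk r v)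
  simp only [LinearIsometry.coe_toContinuousLinearMap, map_smul] at this
  rw [avg_apply, avg_apply, ← this]
  simp_rw [U.trans_comm x]

lemma avg_comm [CompleteSpace H] (U : TranslationRep d H) (hk : Integrable k) (r s : ℝ) (v : H) :
    U.avg hk r (U.avg hk s v) = U.avg hk s (U.avg hk r v) := by
  have := (U.avg hk r).integral_comp_comm (U.integrable_smul_trans hk s v)
  simp only [map_smul] at this
  rw [U.avg_apply hk s, U.avg_apply hk s, ← this]
  simp_rw [U.trans_avg]

open scoped InnerProductSpace in
lemma inner_avg [CompleteSpace H] (U : TranslationRep d H) (hk : Integrable k)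
    (hk' : ∀ y, k (-y) = k y) (r : ℝ)
    (a b : H) : ⟪U.avg hk r a, b⟫_ℝ = ⟪a, U.avg hk r b⟫_ℝ := by
  rw [avg_apply, avg_apply, real_inner_comm, ← integral_inner (U.integrable_smul_trans hk r a),
    ← integral_inner (U.integrable_smul_trans hk r b), ← integral_neg_eq_self]
  congr 1; ext y
  rw [hk', real_inner_comm, real_inner_smul_left, real_inner_smul_right, U.inner_trans, smul_neg,
    neg_neg]

/-- Translating a dilated average costs only the `L¹` modulus of continuity of the kernel. -/
lemma norm_avg_sub_trans_avg_le [CompleteSpace H] (U : TranslationRep d H) (hk : Integrable k)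
    {r : ℝ} (hr : r ≠ 0)
    (x : EuclideanSpace ℝ (Fin d)) (v : H) :
    ‖U.avg hk r v - U.trans x (U.avg hk r v)‖ ≤
      (∫ y, |k y - k (y - r⁻¹ • x)|) * ‖v‖ := by
  have hk2 : Integrable fun y => k (y - r⁻¹ • x) := hk.comp_sub_right _
  have e : U.trans x (U.avg hk r v) = ∫ y, k (y - r⁻¹ • x) • U.trans (r • y) v := by
    rw [trans_avg, avg_apply,
      ← integral_add_right_eq_self (fun y => k (y - r⁻¹ • x) • U.trans (r • y) v) (r⁻¹ • x)]
    congr 1; ext y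
    rw [add_sub_cancel_right, smul_add, smul_inv_smul₀ hr, U.trans_add]
  rw [e, avg_apply, ← integral_sub (U.integrable_smul_trans hk r v)
    (U.integrable_smul_trans hk2 r v), ← integral_mul_const]
  refine (norm_integral_le_integral_norm _).trans (le_of_eq ?_)
  congr 1; ext y
  rw [← sub_smul, norm_smul, LinearIsometry.norm_map, norm_eq_abs]

lemma continuous_avg_prod (U : TranslationRep d H) (hk : Integrable k) :
    Continuous fun p : ℝ × H => U.avg hk p.1 p.2 := by
  have h0 : 0 ≤ ∫ y, |k y| := by positivity
  refine continuous_prod_of_continuous_lipschitzWith' _ (∫ y, |k y|).toNNReal (fun r => ?_)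
    (fun v => ?_)
  · refine LipschitzWith.of_dist_le_mul fun a b => ?_
    rw [dist_eq_norm, dist_eq_norm, ← map_sub, Real.coe_toNNReal _ h0]
    exact U.norm_avg_apply_le hk r _
  · simp only [avg_apply]
    refine continuous_of_dominated (bound := fun y => |k y| * ‖v‖)
      (fun r => (U.integrable_smul_trans hk r v).1) (fun r => .of_forall fun y => ?_)
      (hk.abs.mul_const _) (.of_forall fun y => ?_)
    · rw [norm_smul, LinearIsometry.norm_map, norm_eq_abs]
    · exact ((U.continuous_trans v).comp (by fun_prop)).const_smul _

/-- The increment operator `v ↦ A_{|z|} v - U_w A_{|z|} v`. -/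
def incr (U : TranslationRep d H) (hk : Integrable k) (z w : EuclideanSpace ℝ (Fin d)) :
    H →L[ℝ] H :=
  U.avg hk ‖z‖ - (U.trans w).toContinuousLinearMap.comp (U.avg hk ‖z‖)

lemma incr_apply (U : TranslationRep d H) (hk : Integrable k) (z w : EuclideanSpace ℝ (Fin d))
    (v : H) : U.incr hk z w v = U.avg hk ‖z‖ v - U.trans w (U.avg hk ‖z‖ v) := rfl

lemma norm_incr_apply_le (U : TranslationRep d H) (hk : Integrable k)
    (z w : EuclideanSpace ℝ (Fin d)) (v : H) :
    ‖U.incr hk z w v‖ ≤ 2 * (∫ y, |k y|) * ‖v‖ := by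
  have h1 := norm_sub_le (U.avg hk ‖z‖ v) (U.trans w (U.avg hk ‖z‖ v))
  have h2 := U.norm_avg_apply_le hk ‖z‖ v
  rw [LinearIsometry.norm_map] at h1
  rw [incr_apply]
  linarith

lemma incr_incr_swap_trans [CompleteSpace H] (U : TranslationRep d H) (hk : Integrable k)
    (a b x y : EuclideanSpace ℝ (Fin d)) (v : H) :
    U.incr hk a x (U.incr hk b y v) = U.incr hk a y (U.incr hk b x v) := by
  simp only [incr_apply, map_sub, ← U.trans_avg, U.trans_comm x y]
  abel

lemma incr_incr_swap_scale [CompleteSpace H] (U : TranslationRep d H) (hk : Integrable k)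
    (a b x y : EuclideanSpace ℝ (Fin d)) (v : H) :
    U.incr hk a x (U.incr hk b y v) = U.incr hk b x (U.incr hk a y v) := by
  simp only [incr_apply, map_sub, ← U.trans_avg, U.avg_comm hk ‖a‖ ‖b‖]

open scoped InnerProductSpace in
lemma inner_incr [CompleteSpace H] (U : TranslationRep d H) (hk : Integrable k)
    (hk' : ∀ y, k (-y) = k y)
    (z w : EuclideanSpace ℝ (Fin d)) (a b : H) :
    ⟪U.incr hk z w a, b⟫_ℝ = ⟪a, U.incr hk z (-w) b⟫_ℝ := by
  rw [incr_apply, incr_apply, inner_sub_left, inner_sub_right, U.inner_trans,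
    U.inner_avg hk hk', U.inner_avg hk hk', U.trans_avg]

lemma continuous_incr (U : TranslationRep d H) (hk : Integrable k)
    {f : EuclideanSpace ℝ (Fin d) → EuclideanSpace ℝ (Fin d)} (hf : Continuous f)
    {g : EuclideanSpace ℝ (Fin d) → H} (hg : Continuous g) :
    Continuous fun z => U.incr hk z (f z) (g z) := by
  have h1 : Continuous fun z => U.avg hk ‖z‖ (g z) :=
    (U.continuous_avg_prod hk).comp (continuous_norm.prodMk hg)
  exact h1.sub (U.continuous_trans_prod.comp (hf.prodMk h1))

lemma norm_incr_apply_le_sqrt [CompleteSpace H] (U : TranslationRep d H) (hk : Integrable k) {C : ℝ}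
    (hC : ∀ a, ∫ y, |k y - k (y - a)| ≤ C * √‖a‖)
    {z : EuclideanSpace ℝ (Fin d)} (hz : z ≠ 0) (w : EuclideanSpace ℝ (Fin d)) (v : H) :
    ‖U.incr hk z w v‖ ≤ C * √(‖w‖ / ‖z‖) * ‖v‖ := by
  refine (U.norm_avg_sub_trans_avg_le hk (norm_ne_zero_iff.2 hz) w v).trans ?_
  gcongr
  refine (hC _).trans (le_of_eq ?_)
  rw [norm_smul, norm_inv, norm_norm, inv_mul_eq_div]

lemma incr_zero (U : TranslationRep d H) (hk : Integrable k) (z : EuclideanSpace ℝ (Fin d))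
    (v : H) : U.incr hk z 0 v = 0 := by
  rw [incr_apply, U.trans_zero, sub_self]

lemma norm_incr_incr_le [CompleteSpace H] (U : TranslationRep d H) (hk : Integrable k) {C : ℝ}
    (hC : ∀ a, ∫ y, |k y - k (y - a)| ≤ C * √‖a‖) (z w : EuclideanSpace ℝ (Fin d)) (v : H) :
    ‖U.incr hk w w (U.incr hk z (-z) v)‖ ≤
      2 * (∫ y, |k y|) * C * scaleRatio ‖z‖ ‖w‖ * ‖v‖ := by
  have h0 : 0 ≤ ∫ y, |k y| := by positivity
  rcases eq_or_ne z 0 with rfl | hz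
  · simp [incr_zero, scaleRatio]
  rcases eq_or_ne w 0 with rfl | hw
  · simp [incr_zero, scaleRatio]
  rcases min_choice √(‖w‖ / ‖z‖) √(‖z‖ / ‖w‖) with h | h
  · rw [scaleRatio, h, incr_incr_swap_trans]
    refine (U.norm_incr_apply_le hk _ _ _).trans ?_
    have := mul_le_mul_of_nonneg_left (U.norm_incr_apply_le_sqrt hk hC hz w v) h0
    linarith
  · rw [scaleRatio, h, incr_incr_swap_scale]
    refine (U.norm_incr_apply_le hk _ _ _).trans ?_
    have := mul_le_mul_of_nonneg_left (U.norm_incr_apply_le_sqrt hk hC hw (-z) v) h0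
    rw [norm_neg] at this
    linarith

/-- Square-function estimate for the increments `(1 - U_z) A_{|z|}`. -/
lemma integral_norm_incr_sq_le [CompleteSpace H] (U : TranslationRep d H) (hk : Integrable k)
    (hk' : ∀ y, k (-y) = k y) {C : ℝ} (hC0 : 0 ≤ C)
    (hC : ∀ a, ∫ y, |k y - k (y - a)| ≤ C * √‖a‖)
    (ν : Measure (EuclideanSpace ℝ (Fin d))) [IsFiniteMeasure ν] {L : ℝ} (hL0 : 0 ≤ L)
    (hL : ∀ z : EuclideanSpace ℝ (Fin d), ∫ w, scaleRatio ‖z‖ ‖w‖ ∂ν ≤ L) (v : H) :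
    ∫ z, ‖U.incr hk z z v‖ ^ 2 ∂ν ≤ 2 * (∫ y, |k y|) * C * L * ‖v‖ ^ 2 := by
  have h0 : 0 ≤ ∫ y, |k y| := by positivity
  set c := 2 * ∫ y, |k y|
  have hc : 0 ≤ c := by positivity
  have hT : Continuous fun z => U.incr hk z z v :=
    U.continuous_incr hk continuous_id continuous_const
  have hT' : Continuous fun z => U.incr hk z (-z) (U.incr hk z z v) :=
    U.continuous_incr hk continuous_neg hT
  have hB (z) : ‖U.incr hk z z v‖ ≤ c * ‖v‖ := U.norm_incr_apply_le hk _ _ _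
  have hB' (z) : ‖U.incr hk z (-z) (U.incr hk z z v)‖ ≤ c * (c * ‖v‖) :=
    (U.norm_incr_apply_le hk _ _ _).trans (by gcongr; exact hB z)
  exact integral_norm_sq_le_of_almost_orthogonal ν (fun z => U.incr hk z z)
    (fun z => U.incr hk z (-z)) (fun z w => scaleRatio ‖z‖ ‖w‖) (c * C) L
    (max (c * ‖v‖) (c * (c * ‖v‖))) (by positivity) hL0
    (fun z a b => U.inner_incr hk hk' z z a b) (fun z w v => U.norm_incr_incr_le hk hC z w v)
    (fun z w => scaleRatio_nonneg _ _) (fun z w => scaleRatio_le_one _ _)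
    (fun z w => scaleRatio_comm _ _)
    (measurable_scaleRatio.comp (f := fun p : _ × _ => (‖p.1‖, ‖p.2‖)) (by fun_prop)) hL v
    hT.stronglyMeasurable hT'.stronglyMeasurable
    (fun z => (hB z).trans (le_max_left _ _)) (fun z => (hB' z).trans (le_max_right _ _))

end TranslationRep
/-- The torus `(ℝ / 2πℤ)^d`. -/
abbrev FlatTorus (d : ℕ) : Type := Fin d → AddCircle (2 * π)

instance fact_two_pi_pos : Fact (0 < 2 * π) := ⟨two_pi_pos⟩

/-- The covering map `ℝ^d → (ℝ / 2πℤ)^d`. -/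
def toTorus (d : ℕ) (x : EuclideanSpace ℝ (Fin d)) : FlatTorus d :=
  fun i => (x i : AddCircle (2 * π))

lemma toTorus_add (d : ℕ) (x y : EuclideanSpace ℝ (Fin d)) :
    toTorus d (x + y) = toTorus d x + toTorus d y := by
  ext i; simp [toTorus]

lemma isOpenQuotientMap_toTorus (d : ℕ) : IsOpenQuotientMap (toTorus d) := by
  have h : IsOpenQuotientMap
      (Pi.map fun (_ : Fin d) (t : ℝ) => (t : AddCircle (2 * π))) :=
    .piMap fun _ => QuotientAddGroup.isOpenQuotientMap_mk
  exact h.comp (EuclideanSpace.equiv (Fin d) ℝ).toHomeomorph.isOpenQuotientMap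

lemma continuous_toTorus (d : ℕ) : Continuous (toTorus d) :=
  (isOpenQuotientMap_toTorus d).continuous

lemma measurePreserving_toTorus (d : ℕ) :
    MeasurePreserving (toTorus d) (volume.restrict (Box d)) volume := by
  have h1 := measurePreserving_pi (fun _ : Fin d => volume.restrict (Set.Ioc (-π) (-π + 2 * π)))
    (fun _ : Fin d => (volume : Measure (AddCircle (2 * π))))
    (fun _ => AddCircle.measurePreserving_mk (2 * π) (-π))
  have h2 : Measure.pi (fun _ : Fin d => (volume : Measure ℝ).restrict (Set.Ioc (-π) (-π + 2 * π))) =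
      volume.restrict (Set.univ.pi fun _ : Fin d => Set.Icc (-π) π) := by
    rw [← Measure.restrict_pi_pi, volume_pi]
    refine Measure.restrict_congr_set ?_
    have := Measure.univ_pi_Ioc_ae_eq_Icc (μ := fun _ : Fin d => (volume : Measure ℝ))
      (f := fun _ => -π) (g := fun _ => π)
    rw [← Set.pi_univ_Icc] at this
    rwa [show -π + 2 * π = π by ring]
  rw [h2] at h1
  have h3 := (EuclideanSpace.volume_preserving_symm_measurableEquiv_toLp (Fin d)).restrict_preimage
    (s := Set.univ.pi fun _ : Fin d => Set.Icc (-π) π)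
    (MeasurableSet.univ_pi fun _ => measurableSet_Icc)
  have hB : Box d = (MeasurableEquiv.toLp 2 (Fin d → ℝ)).symm ⁻¹'
      Set.univ.pi fun _ : Fin d => Set.Icc (-π) π := by
    ext x
    simp [Box, Pi.le_def, forall_and]
  rw [hB]
  exact h1.comp h3

lemma integral_comp_toTorus (d : ℕ) {g : FlatTorus d → ℝ} (hg : Continuous g) :
    ∫ x in Box d, g (toTorus d x) = ∫ x, g x := by
  rw [← (measurePreserving_toTorus d).map_eq, integral_map
    (continuous_toTorus d).aemeasurable hg.aestronglyMeasurable]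

/-- A continuous function on `ℝ^d` that is `2π`-periodic in every coordinate descends to the
torus. -/
lemma exists_continuousMap_comp_toTorus {d : ℕ} {f : EuclideanSpace ℝ (Fin d) → ℝ}
    (hf : Continuous f) (hp : TorusPeriodic f) :
    ∃ F : C(FlatTorus d, ℝ), ∀ x, F (toTorus d x) = f x := by
  have hq := isOpenQuotientMap_toTorus d
  have key : ∀ x y, toTorus d x = toTorus d y → f x = f y := by
    intro x y hxy
    have : ∀ i, ∃ m : ℤ, m • (2 * π) = x i - y i := fun i => by
      have := congrFun hxy i
      rw [toTorus, toTorus, ← sub_eq_zero, ← AddCircle.coe_sub, AddCircle.coe_eq_zero_iff] at this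
      exact this
    choose m hm using this
    rw [← hp y m]
    congr 1
    ext i
    have := hm i
    simp only [zsmul_eq_mul] at this
    simp
    linarith
  have hF : ∀ x, f (Function.surjInv hq.surjective (toTorus d x)) = f x := fun x =>
    key _ _ (Function.surjInv_eq hq.surjective _)
  refine ⟨⟨f ∘ Function.surjInv hq.surjective, ?_⟩, hF⟩
  rw [← hq.continuous_comp_iff]
  exact hf.congr fun x => (hF x).symm

lemma TorusPeriodic.norm_fderiv {d : ℕ} {u : EuclideanSpace ℝ (Fin d) → ℝ}
    (hu : TorusPeriodic u) : TorusPeriodic fun x => ‖fderiv ℝ u x‖ := by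
  intro x m
  simp only
  rw [← fderiv_comp_add_right]
  simp_rw [hu _ m]

instance fact_two_ne_top : Fact ((2 : ENNReal) ≠ ⊤) := ⟨ENNReal.ofNat_ne_top⟩

/-- The translation representation on `L²` of the torus. -/
def torusRep (d : ℕ) : TranslationRep d (Lp ℝ 2 (volume : Measure (FlatTorus d))) where
  trans y := Lp.compMeasurePreservingₗᵢ ℝ (fun x => toTorus d y + x)
    (measurePreserving_add_left volume (toTorus d y))
  trans_zero v := by
    have h0 : toTorus d 0 = 0 := by ext i; simp [toTorus]
    refine Lp.ext ((Lp.coeFn_compMeasurePreserving v _).trans ?_)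
    simp [h0, Function.comp_def]
  trans_add x y v := by
    exact (congrArg (fun c => DomAddAct.mk c +ᵥ v) ((toTorus_add d x y).trans (add_comm _ _))).trans
      (add_vadd (DomAddAct.mk (toTorus d x)) (DomAddAct.mk (toTorus d y)) v)
  continuous_trans v := by
    have : ContinuousVAdd (FlatTorus d)ᵈᵃᵃ (Lp ℝ 2 (volume : Measure (FlatTorus d))) :=
      Lp.instContinuousVAddDomAddAct
    have h : Continuous fun y => DomAddAct.mk (toTorus d y) +ᵥ v :=
      (DomAddAct.continuous_mk.comp (continuous_toTorus d)).vadd continuous_const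
    exact h
lemma norm_toLp_sq_eq_setIntegral {d : ℕ} (F : C(FlatTorus d, ℝ)) :
    ‖F.toLp 2 volume ℝ‖ ^ 2 = ∫ x in Box d, F (toTorus d x) ^ 2 := by
  rw [integral_comp_toTorus d (g := fun x => F x ^ 2) (by fun_prop), ← real_inner_self_eq_norm_sq,
    ContinuousMap.inner_toLp]
  simp [sq]

lemma torusRep_trans_toLp {d : ℕ} (y : EuclideanSpace ℝ (Fin d)) (F : C(FlatTorus d, ℝ)) :
    (torusRep d).trans y (F.toLp 2 volume ℝ) =
      (F.comp (ContinuousMap.addLeft (toTorus d y))).toLp 2 volume ℝ := rfl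

section

variable {d : ℕ} {k : EuclideanSpace ℝ (Fin d) → ℝ}

lemma integrable_smul_comp_addLeft (hk : Integrable k) (r : ℝ) (F : C(FlatTorus d, ℝ)) :
    Integrable fun y => k y • F.comp (ContinuousMap.addLeft (toTorus d (r • y))) := by
  have hc : Continuous fun y : EuclideanSpace ℝ (Fin d) =>
      F.comp (ContinuousMap.addLeft (toTorus d (r • y))) :=
    ContinuousMap.continuous_of_continuous_uncurry _ <|
      F.continuous.comp <| (((continuous_toTorus d).comp (continuous_const_smul r)).comp
        continuous_fst).add continuous_snd
  refine Integrable.mono' (hk.norm.mul_const ‖F‖) (hk.1.smul hc.aestronglyMeasurable)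
    (.of_forall fun y => ?_)
  rw [norm_smul]
  gcongr
  exact (ContinuousMap.norm_le _ (norm_nonneg F)).2 fun x => F.norm_coe_le_norm _

lemma torusRep_avg_toLp (hk : Integrable k) (r : ℝ) (F : C(FlatTorus d, ℝ)) :
    (torusRep d).avg hk r (F.toLp 2 volume ℝ) =
      (∫ y, k y • F.comp (ContinuousMap.addLeft (toTorus d (r • y)))).toLp 2 volume ℝ := by
  rw [← ContinuousLinearMap.integral_comp_comm _ (integrable_smul_comp_addLeft hk r F)]
  simp only [map_smul]
  rfl

lemma integral_smul_comp_addLeft_apply (hk : Integrable k) (r : ℝ) (F : C(FlatTorus d, ℝ))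
    (x : EuclideanSpace ℝ (Fin d)) :
    (∫ y, k y • F.comp (ContinuousMap.addLeft (toTorus d (r • y)))) (toTorus d x) =
      ∫ y, k y * F (toTorus d (x + r • y)) := by
  rw [ContinuousMap.integral_apply (integrable_smul_comp_addLeft hk r F)]
  simp [toTorus_add, add_comm]

lemma norm_torusRep_incr_toLp_sq (hk : Integrable k) (z w : EuclideanSpace ℝ (Fin d))
    (F : C(FlatTorus d, ℝ)) :
    ‖(torusRep d).incr hk z w (F.toLp 2 volume ℝ)‖ ^ 2 =
      ∫ x in Box d, ((∫ y, k y * F (toTorus d (x + ‖z‖ • y))) -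
        ∫ y, k y * F (toTorus d (x + w + ‖z‖ • y))) ^ 2 := by
  rw [TranslationRep.incr_apply, torusRep_avg_toLp, torusRep_trans_toLp, ← map_sub,
    norm_toLp_sq_eq_setIntegral]
  congr 1 with x
  have hx : ContinuousMap.addLeft (toTorus d w) (toTorus d x) = toTorus d (x + w) := by
    rw [add_comm x, toTorus_add]
    rfl
  rw [ContinuousMap.sub_apply, ContinuousMap.comp_apply, hx, integral_smul_comp_addLeft_apply hk,
    integral_smul_comp_addLeft_apply hk]

end

open scoped Pointwise in
lemma Davg_eq_integral_truncKernel {d : ℕ} (hd : 1 ≤ d) (u : EuclideanSpace ℝ (Fin d) → ℝ)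
    {r : ℝ} (hr : 0 < r) (x : EuclideanSpace ℝ (Fin d)) :
    Davg d u r x = ∫ y, truncKernel d y * ‖fderiv ℝ u (x + r • y)‖ := by
  have h := Measure.setIntegral_comp_smul_of_pos volume
    (fun z : EuclideanSpace ℝ (Fin d) => ‖fderiv ℝ u (x + z)‖ / ‖z‖ ^ (d - 1))
    (Metric.ball 0 1) hr
  have hball : r • Metric.ball (0 : EuclideanSpace ℝ (Fin d)) 1 = Metric.ball 0 r := by
    rw [smul_ball hr.ne']; simp [abs_of_pos hr]
  rw [hball, finrank_euclideanSpace_fin, smul_eq_mul] at h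
  have h2 : ∫ y, truncKernel d y * ‖fderiv ℝ u (x + r • y)‖ =
      r ^ (d - 1) * ∫ y in Metric.ball (0 : EuclideanSpace ℝ (Fin d)) 1,
        ‖fderiv ℝ u (x + r • y)‖ / ‖r • y‖ ^ (d - 1) := by
    rw [← integral_const_mul, ← integral_indicator measurableSet_ball]
    congr 1 with y
    by_cases hy : y ∈ Metric.ball (0 : EuclideanSpace ℝ (Fin d)) 1
    · rw [truncKernel, Set.indicator_of_mem hy, Set.indicator_of_mem hy, norm_smul,
        Real.norm_of_nonneg hr.le, mul_pow]
      field_simp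
    · rw [truncKernel, Set.indicator_of_notMem hy, Set.indicator_of_notMem hy, zero_mul]
  rw [h2, h, Davg, ← mul_assoc]
  congr 1
  obtain ⟨n, rfl⟩ := Nat.exists_eq_add_of_le' hd
  simp only [Nat.add_sub_cancel]
  field_simp
  ring

/-- The Cauchy–Schwarz inequality for a nonnegative weight. -/
lemma sq_setIntegral_mul_le {X : Type*} [TopologicalSpace X] [MeasurableSpace X]
    [OpensMeasurableSpace X] [T2Space X] {μ : Measure X} [IsFiniteMeasureOnCompacts μ] {s : Set X}
    (hs : IsCompact s) {w g : X → ℝ} (hw : Continuous w) (hw0 : ∀ x, 0 ≤ w x) (hg : Continuous g) :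
    (∫ x in s, w x * g x ∂μ) ^ 2 ≤ (∫ x in s, w x ∂μ) * ∫ x in s, w x * g x ^ 2 ∂μ := by
  have i0 : IntegrableOn w s μ := hw.continuousOn.integrableOn_compact hs
  have i1 : IntegrableOn (fun x => w x * g x) s μ :=
    (hw.mul hg).continuousOn.integrableOn_compact hs
  have i2 : IntegrableOn (fun x => w x * g x ^ 2) s μ :=
    (hw.mul (hg.pow 2)).continuousOn.integrableOn_compact hs
  have h : ∀ t : ℝ, 0 ≤ (∫ x in s, w x ∂μ) * (t * t) + (-2 * ∫ x in s, w x * g x ∂μ) * t +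
      ∫ x in s, w x * g x ^ 2 ∂μ := fun t => by
    have h0 : 0 ≤ ∫ x in s, w x * (g x - t) ^ 2 ∂μ :=
      integral_nonneg fun x => mul_nonneg (hw0 x) (sq_nonneg _)
    have h1 : ∫ x in s, w x * (g x - t) ^ 2 ∂μ =
        ∫ x in s, (w x * (t * t) + (w x * g x) * (-2 * t)) + w x * g x ^ 2 ∂μ := by
      congr 1 with x
      ring
    have i01 : IntegrableOn (fun x => w x * (t * t) + w x * g x * (-2 * t)) s μ :=
      (i0.mul_const _).add (i1.mul_const _)
    rw [h1, integral_add i01 i2, integral_add (i0.mul_const _) (i1.mul_const _), integral_mul_const,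
      integral_mul_const] at h0
    linarith
  have := discrim_le_zero h
  rw [discrim] at this
  nlinarith

lemma continuous_weight (d : ℕ) {h : ℝ} (hh : 0 < h) :
    Continuous fun z : EuclideanSpace ℝ (Fin d) => ((‖z‖ + h) ^ d)⁻¹ :=
  Continuous.inv₀ (by fun_prop) fun z => by positivity

/-- Square function estimate for the weight `(|z|+h)^{-d}`, uniformly in `h`. -/
lemma exists_setIntegral_weight_mul_norm_incr_sq_le (d : ℕ) (hd : 2 ≤ d) :
    ∃ M : ℝ, 0 ≤ M ∧ ∀ h : ℝ, 0 < h → ∀ v : Lp ℝ 2 (volume : Measure (FlatTorus d)),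
      ∫ z in Box d, ((‖z‖ + h) ^ d)⁻¹ *
        ‖(torusRep d).incr (integrable_truncKernel d hd) z z v‖ ^ 2 ≤ M * ‖v‖ ^ 2 := by
  obtain ⟨C, hC0, hC⟩ := exists_integral_abs_truncKernel_sub_le d hd
  obtain ⟨L, hL0, hL⟩ := exists_integral_weight_scaleRatio_le d hd (Box d)
  refine ⟨2 * (∫ y, |truncKernel d y|) * C * L, by positivity, fun h hh v => ?_⟩
  set w : EuclideanSpace ℝ (Fin d) → ℝ := fun z => ((‖z‖ + h) ^ d)⁻¹
  have hw : Continuous w := continuous_weight d hh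
  have hw0 : ∀ z, 0 ≤ w z := fun z => by positivity
  set ν := (volume.restrict (Box d)).withDensity fun z => ENNReal.ofReal (w z)
  have hν : ∀ g : EuclideanSpace ℝ (Fin d) → ℝ, ∫ z, g z ∂ν = ∫ z in Box d, w z * g z := by
    intro g
    rw [integral_withDensity_eq_integral_toReal_smul hw.measurable.ennreal_ofReal
      (.of_forall fun _ => ENNReal.ofReal_lt_top)]
    simp only [ENNReal.toReal_ofReal (hw0 _), smul_eq_mul]
  have : IsFiniteMeasure ν := isFiniteMeasure_withDensity_ofReal
    (hw.continuousOn.integrableOn_compact (isCompact_Box d)).2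
  have := (torusRep d).integral_norm_incr_sq_le (integrable_truncKernel d hd) (truncKernel_neg d)
    hC0 hC ν hL0 (fun z => by rw [hν]; exact hL h hh _ (norm_nonneg z)) v
  rwa [hν] at this

/-- For `d ≥ 2` there are constants `C > 0` and `h₀ ∈ (0,1)`,
depending only on `d`, such that for every continuously differentiable (periodic)
`u : 𝕋^d → ℝ` and every `h ∈ (0,h₀)`,
`∫_{𝕋^d} (|z|+h)^{−d} ‖D_{|z|}u(·) − D_{|z|}u(·+z)‖_{L²(𝕋^d)} dz
  ≤ C |ln h|^{1/2} (‖u‖_{L²(𝕋^d)} + ‖∇u‖_{L²(𝕋^d)})`. -/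
theorem Davg_translation_L2_estimate (d : ℕ) (hd : 2 ≤ d) :
    ∃ C h₀ : ℝ, 0 < C ∧ h₀ ∈ Set.Ioo (0:ℝ) 1 ∧
      ∀ u : EuclideanSpace ℝ (Fin d) → ℝ, ContDiff ℝ 1 u → TorusPeriodic u →
        ∀ h ∈ Set.Ioo (0:ℝ) h₀,
          (∫ z in Box d, ((‖z‖ + h) ^ d)⁻¹ *
              (∫ x in Box d, (Davg d u ‖z‖ x - Davg d u ‖z‖ (x + z)) ^ 2) ^ (1/2 : ℝ)) ≤
            C * |Real.log h| ^ (1/2 : ℝ) *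
              ((∫ x in Box d, u x ^ 2) ^ (1/2 : ℝ) +
                (∫ x in Box d, ‖fderiv ℝ u x‖ ^ 2) ^ (1/2 : ℝ)) := by
  obtain ⟨C₁, hC₁, hweight⟩ := exists_integral_weight_le d hd (isCompact_Box d)
  obtain ⟨M, hM, hsq⟩ := exists_setIntegral_weight_mul_norm_incr_sq_le d hd
  refine ⟨√(C₁ * M) + 1, 1 / 2, by positivity, by norm_num, fun u hu hper h hh => ?_⟩
  obtain ⟨F, hF⟩ := exists_continuousMap_comp_toTorus
    (hu.continuous_fderiv one_ne_zero).norm hper.norm_fderiv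
  set v := F.toLp 2 (volume : Measure (FlatTorus d)) ℝ
  have hk := integrable_truncKernel d hd
  have hv : (∫ x in Box d, ‖fderiv ℝ u x‖ ^ 2) ^ (1/2 : ℝ) = ‖v‖ := by
    rw [← Real.sqrt_eq_rpow, ← Real.sqrt_sq (norm_nonneg v), norm_toLp_sq_eq_setIntegral]
    simp_rw [hF]
  have hD : ∀ z, (∫ x in Box d, (Davg d u ‖z‖ x - Davg d u ‖z‖ (x + z)) ^ 2) ^ (1/2 : ℝ) =
      ‖(torusRep d).incr hk z z v‖ := fun z => by
    rcases eq_or_ne z 0 with rfl | hz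
    · simp [TranslationRep.incr_zero]
    rw [← Real.sqrt_eq_rpow, ← Real.sqrt_sq (norm_nonneg (TranslationRep.incr _ _ _ _ _)),
      norm_torusRep_incr_toLp_sq]
    simp_rw [hF, Davg_eq_integral_truncKernel (by omega : 1 ≤ d) u (norm_pos_iff.2 hz)]
  simp_rw [hD]
  rw [hv, ← Real.sqrt_eq_rpow, ← Real.sqrt_eq_rpow]
  have hcs := sq_setIntegral_mul_le (μ := volume) (isCompact_Box d) (continuous_weight d hh.1)
    (fun z => by have := hh.1; positivity)
    ((torusRep d).continuous_incr hk continuous_id (continuous_const (y := v))).norm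
  have hle : ∫ z in Box d, ((‖z‖ + h) ^ d)⁻¹ * ‖(torusRep d).incr hk z z v‖ ≤
      √(C₁ * M) * √|log h| * ‖v‖ := by
    refine le_of_sq_le_sq (hcs.trans ?_) (by positivity)
    rw [mul_pow, mul_pow, Real.sq_sqrt (by positivity), Real.sq_sqrt (abs_nonneg _),
      show C₁ * M * |log h| * ‖v‖ ^ 2 = (C₁ * |log h|) * (M * ‖v‖ ^ 2) by ring]
    have hh0 := hh.1
    exact mul_le_mul (hweight h hh) (hsq h hh.1 v)
      (integral_nonneg fun z => by positivity) (by positivity)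
  refine hle.trans ?_
  gcongr
  · linarith
  · exact le_add_of_nonneg_left (Real.sqrt_nonneg _)

end
end
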